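/- arXiv:2311.16382 — 6 statements merged into one kernel-verified Lean document; each statement's English description precedes it below -/
import Mathlib

section
/- Let a GS path-based model on the VRS technology set T be given. Suppose (x_o,y_o), (x_p,y_p) ∈ T have efficiency scores θ*_o, θ*_p and both are projected onto the strongly efficient frontier (φ_o(θ*_o) ∈ ∂^S T and φ_p(θ*_p) ∈ ∂^S T). Suppose (x_o,y_o) dominates (x_p,y_p) and the path-flow mapping Φ_{θ*_o} is strictly monotone on T. Then θ*_o > θ*_p. -/
open Finset

noncomputable section

variable {m s n : ℕ}

/-- The VRS technology set generated by data matrices `X`, `Y`. -/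
def Tset (X : Matrix (Fin m) (Fin n) ℝ) (Y : Matrix (Fin s) (Fin n) ℝ) :
    Set ((Fin m → ℝ) × (Fin s → ℝ)) :=
  {p | ∃ lam : Fin n → ℝ, (∀ j, 0 ≤ lam j) ∧ (∑ j, lam j) = 1 ∧
    Matrix.mulVec X lam ≤ p.1 ∧ p.2 ≤ Matrix.mulVec Y lam}

/-- `p` weakly dominates `q`. -/
def WeakDom (p q : (Fin m → ℝ) × (Fin s → ℝ)) : Prop :=
  p.1 ≤ q.1 ∧ q.2 ≤ p.2

/-- `p` dominates `q`. -/
def Dom (p q : (Fin m → ℝ) × (Fin s → ℝ)) : Prop :=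
  WeakDom p q ∧ p ≠ q

/-- A unit is strongly efficient if it lies in `T` and no point of `T` dominates it. -/
def StrongEff (X : Matrix (Fin m) (Fin n) ℝ) (Y : Matrix (Fin s) (Fin n) ℝ)
    (p : (Fin m → ℝ) × (Fin s → ℝ)) : Prop :=
  p ∈ Tset X Y ∧ ∀ q ∈ Tset X Y, ¬ Dom q p

/-- The strongly efficient frontier `∂^S T`. -/
def strongFrontier (X : Matrix (Fin m) (Fin n) ℝ) (Y : Matrix (Fin s) (Fin n) ℝ) :
    Set ((Fin m → ℝ) × (Fin s → ℝ)) :=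
  {p | StrongEff X Y p}

/-- The weakly (but not strongly) efficient frontier `∂^W T = ∂T \ ∂^S T`. -/
def weakFrontier (X : Matrix (Fin m) (Fin n) ℝ) (Y : Matrix (Fin s) (Fin n) ℝ) :
    Set ((Fin m → ℝ) × (Fin s → ℝ)) :=
  frontier (Tset X Y) \ strongFrontier X Y

/-- Componentwise minimum of the input data. -/
def xmin (X : Matrix (Fin m) (Fin n) ℝ) : Fin m → ℝ := fun i => ⨅ j, X i j

/-- Componentwise maximum of the output data. -/
def ymax (Y : Matrix (Fin s) (Fin n) ℝ) : Fin s → ℝ := fun r => ⨆ j, Y r j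

/-- The ideal point `(x^min, y^max)`. -/
def idealPoint (X : Matrix (Fin m) (Fin n) ℝ) (Y : Matrix (Fin s) (Fin n) ℝ) :
    (Fin m → ℝ) × (Fin s → ℝ) :=
  (xmin X, ymax Y)

/-- `T` is an ideal technology: every weakly-but-not-strongly efficient point shares at
least one coordinate with the ideal point. -/
def IdealTech (X : Matrix (Fin m) (Fin n) ℝ) (Y : Matrix (Fin s) (Fin n) ℝ) : Prop :=
  ∀ p ∈ weakFrontier X Y, (∃ i, p.1 i = xmin X i) ∨ (∃ r, p.2 r = ymax Y r)

/-- The pair of path-generating functions `ψ^x, ψ^y` of a GS path-based model, together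
with their domains and the standing assumptions (A1)–(A4). -/
structure GSPsi where
  ψx : ℝ → ℝ
  ψy : ℝ → ℝ
  Dx : Set ℝ
  Dy : Set ℝ
  hDx : Dx = Set.univ ∨ Dx = Set.Ioi (0 : ℝ)
  hDy : Dy = Set.univ ∨ Dy = Set.Ioi (0 : ℝ)
  hψx_diff : DifferentiableOn ℝ ψx Dx
  hψy_diff : DifferentiableOn ℝ ψy Dy
  hψx_conc : ConcaveOn ℝ Dx ψx
  hψy_conv : ConvexOn ℝ Dy ψy
  hψx_mono : StrictMonoOn ψx Dx
  hψy_anti : StrictAntiOn ψy Dy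
  hone_x : (1 : ℝ) ∈ Dx
  hone_y : (1 : ℝ) ∈ Dy
  hψx_one : ψx 1 = 1
  hψy_one : ψy 1 = 1
  himx : ψx '' Dx = Set.univ ∨ ψx '' Dx = Set.Ioi (0 : ℝ)
  himy : ψy '' Dy = Set.univ ∨ ψy '' Dy = Set.Ioi (0 : ℝ)

/-- The common domain `D = dom ψ^x ∩ dom ψ^y`. -/
def GSPsi.D (P : GSPsi) : Set ℝ := P.Dx ∩ P.Dy

/-- A GS path-based model: path-generating functions plus a direction assignment. -/
structure GSModel (X : Matrix (Fin m) (Fin n) ℝ) (Y : Matrix (Fin s) (Fin n) ℝ)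
    extends GSPsi where
  g : (Fin m → ℝ) × (Fin s → ℝ) → (Fin m → ℝ) × (Fin s → ℝ)
  hg_nonneg : ∀ p ∈ Tset X Y, 0 ≤ (g p).1 ∧ 0 ≤ (g p).2
  hg_ne : ∀ p ∈ Tset X Y, g p ≠ 0

variable {X : Matrix (Fin m) (Fin n) ℝ} {Y : Matrix (Fin s) (Fin n) ℝ}

/-- Input component of the path `φ_o`. -/
def GSModel.pathx (M : GSModel X Y) (p : (Fin m → ℝ) × (Fin s → ℝ)) (θ : ℝ) :
    Fin m → ℝ :=
  p.1 + (M.ψx θ - 1) • (M.g p).1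

/-- Output component of the path `φ_o`. -/
def GSModel.pathy (M : GSModel X Y) (p : (Fin m → ℝ) × (Fin s → ℝ)) (θ : ℝ) :
    Fin s → ℝ :=
  p.2 + (M.ψy θ - 1) • (M.g p).2

/-- The path `φ_o(θ)`. -/
def GSModel.path (M : GSModel X Y) (p : (Fin m → ℝ) × (Fin s → ℝ)) (θ : ℝ) :
    (Fin m → ℝ) × (Fin s → ℝ) :=
  (M.pathx p θ, M.pathy p θ)

/-- `θ` is feasible for the unit `p` in the programme `(GS)_o`. -/
def GSModel.feasible (M : GSModel X Y) (p : (Fin m → ℝ) × (Fin s → ℝ)) (θ : ℝ) :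
    Prop :=
  θ ∈ M.toGSPsi.D ∧ ∃ lam : Fin n → ℝ, (∀ j, 0 ≤ lam j) ∧ (∑ j, lam j) = 1 ∧
    Matrix.mulVec X lam ≤ M.pathx p θ ∧ M.pathy p θ ≤ Matrix.mulVec Y lam

/-- The path-flow mapping `Φ_θ` is monotone on `T`. -/
def GSModel.flowMono (M : GSModel X Y) (θ : ℝ) : Prop :=
  ∀ p ∈ Tset X Y, ∀ q ∈ Tset X Y, WeakDom p q → WeakDom (M.path p θ) (M.path q θ)

/-- The path-flow mapping `Φ_θ` is strictly monotone on `T`. -/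
def GSModel.flowStrictMono (M : GSModel X Y) (θ : ℝ) : Prop :=
  M.flowMono θ ∧
    ∀ p ∈ Tset X Y, ∀ q ∈ Tset X Y, Dom p q → Dom (M.path p θ) (M.path q θ)

/-- if two units are both projected onto the strongly efficient frontier,
one dominates the other, and the path-flow mapping at `θ*_o` is strictly monotone on
`T`, then `θ*_o > θ*_p`. -/
theorem stmt2 (M : GSModel X Y)
    (score : ((Fin m → ℝ) × (Fin s → ℝ)) → ℝ)
    (hscore : ∀ p ∈ Tset X Y, IsLeast {θ | M.feasible p θ} (score p))
    (p q : (Fin m → ℝ) × (Fin s → ℝ)) (hp : p ∈ Tset X Y) (hq : q ∈ Tset X Y)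
    (hpo : M.path p (score p) ∈ strongFrontier X Y)
    (hqo : M.path q (score q) ∈ strongFrontier X Y)
    (hdom : Dom p q)
    (hflow : M.flowStrictMono (score p)) :
    score q < score p := by
  have hpath : Dom (M.path p (score p)) (M.path q (score p)) := hflow.2 p hp q hq hdom
  obtain ⟨lam, hnonneg, hsum, hX, hY⟩ := hpo.1
  have hfeas : M.feasible q (score p) :=
    ⟨(hscore p hp).1.1, lam, hnonneg, hsum, hX.trans hpath.1.1, hpath.1.2.trans hY⟩
  refine lt_of_le_of_ne ((hscore q hq).2 hfeas) fun heq => ?_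
  rw [heq] at hqo
  exact hqo.2 _ hpo.1 hpath

end
end

section
/- Let a GS path-based model on the VRS technology set T be given, let D* denote the set of efficiency scores θ*_o achieved by units (x_o,y_o) ∈ T, and assume the path-flow mapping Φ_{θ*} is strictly monotone on T for every θ* ∈ D*. If every unit of T is projected onto the strongly efficient frontier (φ_o(θ*_o) ∈ ∂^S T for all (x_o,y_o) ∈ T), then the model satisfies strict monotonicity: whenever (x_o,y_o) ∈ T dominates (x_p,y_p) ∈ T, one has θ*_o > θ*_p. -/
open Finset

noncomputable section

variable {m s n : ℕ}

variable {X : Matrix (Fin m) (Fin n) ℝ} {Y : Matrix (Fin s) (Fin n) ℝ}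

/-- if the path-flow mappings are strictly monotone at every achieved score
and every unit is projected onto the strongly efficient frontier, then the model is
strictly monotone. -/
theorem stmt3 (M : GSModel X Y)
    (score : ((Fin m → ℝ) × (Fin s → ℝ)) → ℝ)
    (hscore : ∀ p ∈ Tset X Y, IsLeast {θ | M.feasible p θ} (score p))
    (hflow : ∀ θ ∈ score '' Tset X Y, M.flowStrictMono θ)
    (hproj : ∀ p ∈ Tset X Y, M.path p (score p) ∈ strongFrontier X Y) :
    ∀ p ∈ Tset X Y, ∀ q ∈ Tset X Y, Dom p q → score q < score p := by
  intro p hp q hq hpq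
  by_contra! hle
  obtain ⟨⟨hpx, hpy⟩, lam, hlam0, hlam1, hX, hY⟩ := (hscore p hp).1
  obtain ⟨hqx, hqy⟩ := (hscore q hq).1.1
  obtain ⟨hgx, hgy⟩ := M.hg_nonneg p hp
  refine (hproj q hq).2 _ ?_ ((hflow _ ⟨q, hq, rfl⟩).2 p hp q hq hpq)
  refine ⟨lam, hlam0, hlam1, hX.trans ?_, le_trans ?_ hY⟩
  · have hψ := M.hψx_mono.monotoneOn hpx hqx hle
    exact add_le_add_right
      (smul_le_smul_of_nonneg_right (sub_le_sub_right hψ 1) hgx) p.1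
  · have hψ := M.hψy_anti.antitoneOn hpy hqy hle
    exact add_le_add_right
      (smul_le_smul_of_nonneg_right (sub_le_sub_right hψ 1) hgy) p.2

end
end

section
/- Let a GS path-based model on the VRS technology set T use, for some θ_min ∈ [0,1) ∩ D, the GS range directions g^x_o = (x_o − x^min)/(1 − ψ^x(θ_min)), g^y_o = (y^max − y_o)/(ψ^y(θ_min) − 1). Then every unit (x_o,y_o) ∈ T with (x_o,y_o) ≠ (x^min, y^max) has efficiency score θ*_o ≥ θ_min. -/
open Finset

noncomputable section

variable {m s n : ℕ}

/-- The GS range direction with parameter `θ_min` for the unit `p`. -/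
def rangeDir (P : GSPsi) (X : Matrix (Fin m) (Fin n) ℝ) (Y : Matrix (Fin s) (Fin n) ℝ)
    (θmin : ℝ) (p : (Fin m → ℝ) × (Fin s → ℝ)) : (Fin m → ℝ) × (Fin s → ℝ) :=
  ((1 - P.ψx θmin)⁻¹ • (p.1 - xmin X), (P.ψy θmin - 1)⁻¹ • (ymax Y - p.2))

/-- Input component of the path with GS range directions. -/
def pathRx (P : GSPsi) (X : Matrix (Fin m) (Fin n) ℝ) (Y : Matrix (Fin s) (Fin n) ℝ)
    (θmin : ℝ) (p : (Fin m → ℝ) × (Fin s → ℝ)) (θ : ℝ) : Fin m → ℝ :=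
  p.1 + (P.ψx θ - 1) • (rangeDir P X Y θmin p).1

/-- Output component of the path with GS range directions. -/
def pathRy (P : GSPsi) (X : Matrix (Fin m) (Fin n) ℝ) (Y : Matrix (Fin s) (Fin n) ℝ)
    (θmin : ℝ) (p : (Fin m → ℝ) × (Fin s → ℝ)) (θ : ℝ) : Fin s → ℝ :=
  p.2 + (P.ψy θ - 1) • (rangeDir P X Y θmin p).2

/-- The path with GS range directions. -/
def pathR (P : GSPsi) (X : Matrix (Fin m) (Fin n) ℝ) (Y : Matrix (Fin s) (Fin n) ℝ)
    (θmin : ℝ) (p : (Fin m → ℝ) × (Fin s → ℝ)) (θ : ℝ) :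
    (Fin m → ℝ) × (Fin s → ℝ) :=
  (pathRx P X Y θmin p θ, pathRy P X Y θmin p θ)

/-- `θ` is feasible for `p` in the GS programme with GS range directions. -/
def feasibleR (P : GSPsi) (X : Matrix (Fin m) (Fin n) ℝ) (Y : Matrix (Fin s) (Fin n) ℝ)
    (θmin : ℝ) (p : (Fin m → ℝ) × (Fin s → ℝ)) (θ : ℝ) : Prop :=
  θ ∈ P.D ∧ ∃ lam : Fin n → ℝ, (∀ j, 0 ≤ lam j) ∧ (∑ j, lam j) = 1 ∧
    Matrix.mulVec X lam ≤ pathRx P X Y θmin p θ ∧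
    pathRy P X Y θmin p θ ≤ Matrix.mulVec Y lam

/-- A weighted average of finitely many reals is at least their infimum. -/
theorem ciInf_le_dotProduct {n : ℕ} (a w : Fin n → ℝ) (hw : ∀ j, 0 ≤ w j)
    (hsum : ∑ j, w j = 1) : ⨅ j, a j ≤ a ⬝ᵥ w := by
  calc ⨅ j, a j = ∑ j, (⨅ j, a j) * w j := by rw [← Finset.mul_sum, hsum, mul_one]
    _ ≤ a ⬝ᵥ w := Finset.sum_le_sum fun j _ =>
      mul_le_mul_of_nonneg_right (ciInf_le (Set.finite_range a).bddBelow j) (hw j)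

/-- A weighted average of finitely many reals is at most their supremum. -/
theorem dotProduct_le_ciSup {n : ℕ} (a w : Fin n → ℝ) (hw : ∀ j, 0 ≤ w j)
    (hsum : ∑ j, w j = 1) : a ⬝ᵥ w ≤ ⨆ j, a j := by
  calc a ⬝ᵥ w ≤ ∑ j, (⨆ j, a j) * w j := Finset.sum_le_sum fun j _ =>
      mul_le_mul_of_nonneg_right (le_ciSup (Set.finite_range a).bddAbove j) (hw j)
    _ = ⨆ j, a j := by rw [← Finset.mul_sum, hsum, mul_one]

/-- Moving from `a + d` towards `a` by more than `d ≥ 0` stays above `a` only if `d = 0`. -/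
theorem eq_zero_of_le_add_mul_inv_mul {a d u v : ℝ} (hd : 0 ≤ d) (huv : u < v) (hv : v < 1)
    (h : a ≤ a + d + (u - 1) * ((1 - v)⁻¹ * d)) : d = 0 := by
  have hv' : 0 < 1 - v := sub_pos.2 hv
  have hmul : 0 ≤ (u - v) * d := by
    have key : d + (u - 1) * ((1 - v)⁻¹ * d) = (u - v) * d * (1 - v)⁻¹ := by
      field_simp
      ring
    have : 0 ≤ (u - v) * d * (1 - v)⁻¹ := by linarith
    exact nonneg_of_mul_nonneg_left this (inv_pos.2 hv')
  nlinarith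

/-- with GS range directions, every unit other than the ideal point has
efficiency score at least `θ_min`. -/
theorem stmt5 (hn : 0 < n) (X : Matrix (Fin m) (Fin n) ℝ) (Y : Matrix (Fin s) (Fin n) ℝ)
    (P : GSPsi) (θmin : ℝ) (hθ : θmin ∈ Set.Ico (0 : ℝ) 1 ∩ P.D)
    (score : ((Fin m → ℝ) × (Fin s → ℝ)) → ℝ)
    (hscore : ∀ p ∈ Tset X Y, p ≠ idealPoint X Y →
      IsLeast {θ | feasibleR P X Y θmin p θ} (score p)) :
    ∀ p ∈ Tset X Y, p ≠ idealPoint X Y → θmin ≤ score p := by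
  intro p hp hne
  obtain ⟨⟨hD, lam, hlam, hsum, hx, hy⟩, -⟩ := hscore p hp hne
  by_contra! hlt
  obtain ⟨mu, hmu, hmusum, hpx, hpy⟩ := hp
  have hψx : P.ψx (score p) < P.ψx θmin := P.hψx_mono hD.1 hθ.2.1 hlt
  have hψx1 : P.ψx θmin < 1 := P.hψx_one ▸ P.hψx_mono hθ.2.1 P.hone_x hθ.1.2
  have hψy : P.ψy θmin < P.ψy (score p) := P.hψy_anti hD.2 hθ.2.2 hlt
  have hψy1 : 1 < P.ψy θmin := P.hψy_one ▸ P.hψy_anti hθ.2.2 P.hone_y hθ.1.2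
  refine hne (Prod.ext (funext fun i => ?_) (funext fun r => ?_))
  · have hd : 0 ≤ p.1 i - xmin X i :=
      sub_nonneg.2 ((ciInf_le_dotProduct (X i) mu hmu hmusum).trans (hpx i))
    have h : xmin X i ≤ p.1 i + (P.ψx (score p) - 1) *
        ((1 - P.ψx θmin)⁻¹ * (p.1 i - xmin X i)) :=
      (ciInf_le_dotProduct (X i) lam hlam hsum).trans (hx i)
    exact sub_eq_zero.1 (eq_zero_of_le_add_mul_inv_mul (a := xmin X i)
      (d := p.1 i - xmin X i) hd hψx hψx1 (by linarith))
  · have hd : 0 ≤ ymax Y r - p.2 r :=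
      sub_nonneg.2 ((hpy r).trans (dotProduct_le_ciSup (Y r) mu hmu hmusum))
    have h : p.2 r + (P.ψy (score p) - 1) *
        ((P.ψy θmin - 1)⁻¹ * (ymax Y r - p.2 r)) ≤ ymax Y r :=
      (hy r).trans (dotProduct_le_ciSup (Y r) lam hlam hsum)
    refine (sub_eq_zero.1 (eq_zero_of_le_add_mul_inv_mul (a := -ymax Y r) (d := ymax Y r - p.2 r)
      (u := 2 - P.ψy (score p)) (v := 2 - P.ψy θmin) hd (by linarith) (by linarith) ?_)).symm
    rw [show 1 - (2 - P.ψy θmin) = P.ψy θmin - 1 by ring]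
    linarith

end
end

section
/- Let T be an ideal technology set. For a point (x̂,ŷ) ∈ T define the index sets I = {i ∈ {1,…,m} : x̂_i = x^min_i} and R = {r ∈ {1,…,s} : ŷ_r = y^max_r}, and let F_{I,R} = {(x,y) ∈ T : x_i = x^min_i for all i ∈ I, y_r = y^max_r for all r ∈ R}. Then (x̂,ŷ) either belongs to ∂^S T, or it belongs to the relative interior of F_{I,R}, which is a face of T of affine dimension m + s − |I| − |R|. -/
open Finset

noncomputable section

variable {m s n : ℕ}

/-- The face `F_{I,R}` of `T` determined by the coordinates where `p` agrees with the
ideal point. -/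
def FIR (X : Matrix (Fin m) (Fin n) ℝ) (Y : Matrix (Fin s) (Fin n) ℝ)
    (p : (Fin m → ℝ) × (Fin s → ℝ)) : Set ((Fin m → ℝ) × (Fin s → ℝ)) :=
  {q ∈ Tset X Y | (∀ i, p.1 i = xmin X i → q.1 i = xmin X i) ∧
    (∀ r, p.2 r = ymax Y r → q.2 r = ymax Y r)}

/-- The upward closure of the convex hull of the points `P j`. -/
def upperHull {ι : Type*} {n : ℕ} (P : Fin n → ι → ℝ) : Set (ι → ℝ) :=
  {z | ∃ lam : Fin n → ℝ, (∀ j, 0 ≤ lam j) ∧ ∑ j, lam j = 1 ∧ ∀ k, ∑ j, lam j * P j k ≤ z k}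

namespace upperHull

variable {ι : Type*} {n : ℕ} {P : Fin n → ι → ℝ}

theorem mem_of_le {z z' : ι → ℝ} (hz : z ∈ upperHull P) (h : z ≤ z') : z' ∈ upperHull P := by
  obtain ⟨lam, h0, h1, h2⟩ := hz
  exact ⟨lam, h0, h1, fun k => (h2 k).trans (h k)⟩

theorem point_mem (j : Fin n) : P j ∈ upperHull P :=
  ⟨Pi.single j 1, fun i => by by_cases h : i = j <;> simp [h], by simp,
    fun k => by simp [Pi.single_apply]⟩

theorem convex : Convex ℝ (upperHull P) := by
  rintro x ⟨l, l0, l1, l2⟩ y ⟨l', l0', l1', l2'⟩ a b ha hb hab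
  refine ⟨fun j => a * l j + b * l' j, fun j => ?_, ?_, fun k => ?_⟩
  · have := l0 j
    have := l0' j
    positivity
  · rw [sum_add_distrib, ← mul_sum, ← mul_sum, l1, l1']
    linarith
  · have : ∑ j, (a * l j + b * l' j) * P j k
        = a * ∑ j, l j * P j k + b * ∑ j, l' j * P j k := by
      rw [mul_sum, mul_sum, ← sum_add_distrib]
      exact sum_congr rfl fun j _ => by ring
    rw [this]
    exact add_le_add (mul_le_mul_of_nonneg_left (l2 k) ha) (mul_le_mul_of_nonneg_left (l2' k) hb)

theorem lower_bound {b : ι → ℝ} (hb : ∀ j k, b k ≤ P j k) {z : ι → ℝ} (hz : z ∈ upperHull P)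
    (k : ι) : b k ≤ z k := by
  obtain ⟨l, l0, l1, l2⟩ := hz
  calc b k = ∑ j, l j * b k := by rw [← sum_mul, l1, one_mul]
    _ ≤ ∑ j, l j * P j k := sum_le_sum fun j _ => mul_le_mul_of_nonneg_left (hb j k) (l0 j)
    _ ≤ z k := l2 k

variable [Fintype ι]

/-- A nonnegative functional bounded below on the generators is bounded below on the hull. -/
theorem le_dotProduct {w : ι → ℝ} (hw : 0 ≤ w) {c : ℝ} (h : ∀ j, c ≤ dotProduct w (P j))
    {z : ι → ℝ} (hz : z ∈ upperHull P) : c ≤ dotProduct w z := by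
  obtain ⟨l, l0, l1, l2⟩ := hz
  calc c = ∑ j, l j * c := by rw [← sum_mul, l1, one_mul]
    _ ≤ ∑ j, l j * dotProduct w (P j) :=
        sum_le_sum fun j _ => mul_le_mul_of_nonneg_left (h j) (l0 j)
    _ = dotProduct w (fun k => ∑ j, l j * P j k) := by
        simp only [dotProduct, mul_sum]
        rw [sum_comm]
        exact sum_congr rfl fun j _ => sum_congr rfl fun k _ => by ring
    _ ≤ dotProduct w z := dotProduct_le_dotProduct_of_nonneg_left l2 hw

/-- A point of the hull which cannot be improved simultaneously in all coordinates outside `K`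
admits a supporting functional, depending on those coordinates only, of the slice through it
along `K`. -/
theorem exists_slice_support [DecidableEq ι] (K : ι → Prop) [DecidablePred K] {p : ι → ℝ}
    (hp : p ∈ upperHull P)
    (hno : ∀ ε > 0, (fun k => if K k then p k else p k - ε) ∉ upperHull P) :
    ∃ w : ι → ℝ, 0 ≤ w ∧ w ≠ 0 ∧ (∀ k, K k → w k = 0) ∧
      ∀ u ∈ upperHull P, (∀ k, K k → u k = p k) → dotProduct w p ≤ dotProduct w u := by
  set G : Set (ι → ℝ) := {u | (fun k => if K k then p k else u k) ∈ upperHull P} with hG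
  have hGp : ∀ u, (∀ k, ¬ K k → p k ≤ u k) → u ∈ G := fun u hu =>
    mem_of_le hp fun k => by
      by_cases hk : K k
      · simp [hk]
      · simpa [hk] using hu k hk
  have hGc : Convex ℝ G := by
    intro x hx y hy a b ha hb hab
    have := convex hx hy ha hb hab
    change (fun k => if K k then p k else (a • x + b • y) k) ∈ upperHull P
    convert this using 1
    funext k
    by_cases hk : K k
    · simp [hk, ← add_mul, hab]
    · simp [hk]
  have hpn : p ∉ interior G := by
    intro h
    rw [mem_interior_iff_mem_nhds, Metric.mem_nhds_iff] at h
    obtain ⟨ε, hε, h⟩ := h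
    refine hno (ε / 2) (by positivity) (@h (fun k => p k - ε / 2) ?_)
    rw [Metric.mem_ball, dist_pi_lt_iff hε]
    intro k
    rw [Real.dist_eq, sub_sub_cancel_left, abs_neg, abs_of_pos (by positivity)]
    linarith
  have hGi : (interior G).Nonempty := by
    refine ⟨fun k => p k + 1, ?_⟩
    rw [mem_interior_iff_mem_nhds, Metric.mem_nhds_iff]
    refine ⟨1, one_pos, fun u hu => hGp u fun k _ => ?_⟩
    rw [Metric.mem_ball, dist_pi_lt_iff one_pos] at hu
    have := hu k
    rw [Real.dist_eq, abs_lt] at this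
    linarith
  obtain ⟨f, hf⟩ := geometric_hahn_banach_open_point hGc.interior isOpen_interior hpn
  have hfG : ∀ u ∈ G, f u ≤ f p := by
    intro u hu
    have hu' : u ∈ closure (interior G) := by
      rw [hGc.closure_interior_eq_closure_of_nonempty_interior hGi]
      exact subset_closure hu
    exact closure_minimal (fun v hv => (hf v hv).le) (isClosed_le f.continuous continuous_const) hu'
  have hfw : ∀ v, dotProduct (fun k => - f (Pi.single k 1)) v = - f v := by
    intro v
    have := LinearMap.pi_apply_eq_sum_univ f.toLinearMap v
    simp only [ContinuousLinearMap.coe_coe] at this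
    rw [this]
    simp only [dotProduct, ← sum_neg_distrib, smul_eq_mul]
    refine sum_congr rfl fun k _ => ?_
    have : (Pi.single k (1 : ℝ) : ι → ℝ) = fun j => if k = j then 1 else 0 := by
      funext j
      simp [Pi.single_apply, eq_comm]
    rw [this]
    ring
  refine ⟨fun k => - f (Pi.single k 1), fun k => ?_, fun h0 => ?_, fun k hk => ?_,
    fun u hu huK => ?_⟩
  · have := hfG (p + Pi.single k 1) (hGp _ fun i _ => by
      by_cases h : i = k <;> simp [h])
    rw [map_add] at this
    simp only [Pi.zero_apply]
    linarith
  · obtain ⟨v, hv⟩ := hGi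
    have h1 := hf v hv
    have h2 := hfw v
    have h3 := hfw p
    rw [h0, zero_dotProduct] at h2 h3
    linarith
  · have h1 := hfG (p + Pi.single k 1) (hGp _ fun i _ => by
      by_cases h : i = k <;> simp [h])
    have h2 := hfG (p - Pi.single k 1) (hGp _ fun i hi => by
      have h : i ≠ k := fun h => hi (h ▸ hk)
      simp [h])
    rw [map_add] at h1
    rw [map_sub] at h2
    simp only
    linarith
  · rw [hfw, hfw]
    refine neg_le_neg (hfG u ?_)
    change (fun k => if K k then p k else u k) ∈ upperHull P
    convert hu using 1
    funext k
    by_cases hk : K k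
    · simp [hk, huK k hk]
    · simp [hk]

/-- A supporting functional of a slice along minimal coordinates extends to a supporting
functional of the whole hull. -/
theorem exists_support_extension {p : ι → ℝ} (K : ι → Prop) [DecidablePred K]
    (hK : ∀ k, K k → ∀ j, p k ≤ P j k) {w : ι → ℝ}
    (hw : ∀ u ∈ upperHull P, (∀ k, K k → u k = p k) → dotProduct w p ≤ dotProduct w u) :
    ∃ w' : ι → ℝ, w ≤ w' ∧ ∀ j, dotProduct w' p ≤ dotProduct w' (P j) := by
  set e : ι → ℝ := fun k => if K k then 1 else 0 with he
  have key : ∀ j, ∀ᶠ M : ℝ in Filter.atTop,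
      dotProduct (w + M • e) p ≤ dotProduct (w + M • e) (P j) := by
    intro j
    have hterm : ∀ k ∈ univ, 0 ≤ e k * (P j k - p k) := fun k _ => by
      by_cases hk : K k
      · simpa [he, hk] using hK k hk j
      · simp [he, hk]
    have hdiff : dotProduct e (P j) - dotProduct e p = ∑ k, e k * (P j k - p k) := by
      rw [← dotProduct_sub]
      rfl
    simp only [add_dotProduct, smul_dotProduct, smul_eq_mul]
    rcases (sum_nonneg hterm).eq_or_lt with h0 | hpos
    · have heq := (sum_eq_zero_iff_of_nonneg hterm).1 h0.symm
      have := hw (P j) (point_mem j) fun k hk => by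
        have := heq k (mem_univ k)
        simp only [he, hk, if_true, one_mul] at this
        linarith
      rw [← h0] at hdiff
      have h2 : dotProduct e (P j) = dotProduct e p := by linarith
      exact Filter.Eventually.of_forall fun M => by rw [h2]; linarith
    · rw [← hdiff] at hpos
      filter_upwards [Filter.eventually_ge_atTop
        ((dotProduct w p - dotProduct w (P j)) / (dotProduct e (P j) - dotProduct e p))] with M hM
      rw [div_le_iff₀ hpos] at hM
      linarith
  obtain ⟨M, hM, hM0⟩ :=
    ((Filter.eventually_all.2 key).and (Filter.eventually_ge_atTop (0 : ℝ))).exists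
  refine ⟨w + M • e, fun k => ?_, hM⟩
  by_cases hk : K k <;> simp [he, hk, hM0]

/-- Among the supporting functionals at `p` above `w`, take one with minimal coordinate sum: if
its `k`-th coordinate exceeds that of `w`, then it is tight at a generator that differs from `p`
in the `k`-th coordinate. -/
theorem exists_minimal_support [DecidableEq ι] {p w w' : ι → ℝ} (hww' : w ≤ w')
    (hw' : ∀ j, dotProduct w' p ≤ dotProduct w' (P j)) :
    ∃ v : ι → ℝ, w ≤ v ∧ (∀ j, dotProduct v p ≤ dotProduct v (P j)) ∧
      ∀ k, w k < v k → ∃ j, dotProduct v (P j) = dotProduct v p ∧ P j k ≠ p k := by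
  have hcont : ∀ z : ι → ℝ, Continuous fun v : ι → ℝ => dotProduct v z := fun z =>
    continuous_finsetSum _ fun k _ => (continuous_apply k).mul continuous_const
  set W : Set (ι → ℝ) := Set.Icc w w' ∩ ⋂ j, {v | dotProduct v p ≤ dotProduct v (P j)} with hW
  have hWc : IsCompact W :=
    isCompact_Icc.inter_right (isClosed_iInter fun j => isClosed_le (hcont p) (hcont (P j)))
  have hWn : W.Nonempty := ⟨w', ⟨hww', le_rfl⟩, Set.mem_iInter.2 hw'⟩
  obtain ⟨v, ⟨⟨hv1, hv2⟩, hv3⟩, hmin⟩ := hWc.exists_isMinOn hWn (hcont 1).continuousOn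
  replace hv3 : ∀ j, dotProduct v p ≤ dotProduct v (P j) := fun j => Set.mem_iInter.1 hv3 j
  refine ⟨v, hv1, hv3, fun k hk => ?_⟩
  by_contra! hcon
  have key : ∀ j, ∀ᶠ t : ℝ in nhdsWithin 0 (Set.Ioi 0),
      dotProduct (v - Pi.single k t) p ≤ dotProduct (v - Pi.single k t) (P j) := by
    intro j
    simp only [sub_dotProduct, single_dotProduct]
    rcases (hv3 j).eq_or_lt with h | h
    · rw [hcon j h.symm, h]
      exact Filter.Eventually.of_forall fun t => le_rfl
    · refine Filter.Eventually.filter_mono nhdsWithin_le_nhds ?_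
      have h' : dotProduct v p - 0 * p k < dotProduct v (P j) - 0 * P j k := by simpa using h
      have c1 : Continuous fun t : ℝ => dotProduct v p - t * p k := by fun_prop
      have c2 : Continuous fun t : ℝ => dotProduct v (P j) - t * P j k := by fun_prop
      exact (c1.continuousAt.eventually_lt c2.continuousAt h').mono fun t ht => ht.le
  have hsmall : ∀ᶠ t : ℝ in nhdsWithin 0 (Set.Ioi 0), t < v k - w k :=
    Filter.Eventually.filter_mono nhdsWithin_le_nhds (eventually_lt_nhds (sub_pos.2 hk))
  obtain ⟨t, ⟨ht, hts⟩, ht0⟩ :=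
    (((Filter.eventually_all.2 key).and hsmall).and self_mem_nhdsWithin).exists
  change 0 < t at ht0
  have hmem : v - Pi.single k t ∈ W := by
    refine ⟨⟨fun i => ?_, fun i => ?_⟩, Set.mem_iInter.2 ht⟩
    · by_cases hi : i = k
      · subst hi
        simp only [Pi.sub_apply, Pi.single_eq_same]
        linarith
      · simpa [Pi.single_apply, hi] using hv1 i
    · refine le_trans ?_ (hv2 i)
      by_cases hi : i = k
      · subst hi
        simp [ht0.le]
      · simp [hi]
  have := hmin hmem
  simp only [Set.mem_ofPred_eq, sub_dotProduct, single_dotProduct, Pi.one_apply, mul_one] at this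
  linarith

/-- Suppose every dominated point with a supporting functional shares a coordinate with the
lower bound `b`. Then a dominated point can be improved simultaneously in all coordinates in
which it differs from `b`. -/
theorem exists_improvement [DecidableEq ι] {b : ι → ℝ} (hb : ∀ j k, b k ≤ P j k)
    (hideal : ∀ z ∈ upperHull P, ∀ w : ι → ℝ, 0 ≤ w → w ≠ 0 →
      (∀ u ∈ upperHull P, dotProduct w z ≤ dotProduct w u) →
      (∃ q ∈ upperHull P, q ≤ z ∧ q ≠ z) → ∃ k, z k = b k)
    {p : ι → ℝ} (hp : p ∈ upperHull P) (hdom : ∃ q ∈ upperHull P, q ≤ p ∧ q ≠ p) :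
    ∃ ε > 0, (fun k => if p k = b k then p k else p k - ε) ∈ upperHull P := by
  by_contra! hno
  obtain ⟨w₀, hw0, hwne, hwK, hws⟩ := exists_slice_support (fun k => p k = b k) hp hno
  obtain ⟨w₁, hw01, hw1⟩ :=
    exists_support_extension (fun k => p k = b k) (fun k hk j => hk.trans_le (hb j k)) hws
  obtain ⟨w, hw0w, hwsupp, hwtight⟩ := exists_minimal_support hw01 hw1
  have hwnn : 0 ≤ w := hw0.trans hw0w
  have hwnz : w ≠ 0 := fun h => hwne (le_antisymm (h ▸ hw0w) hw0)
  have hvalid : ∀ u ∈ upperHull P, dotProduct w p ≤ dotProduct w u := fun u hu =>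
    le_dotProduct hwnn hwsupp hu
  have hex : ∀ k, ∃ z ∈ upperHull P, dotProduct w z = dotProduct w p ∧ b k < z k := by
    intro k
    by_cases hk : p k = b k
    · rcases (hwnn k).eq_or_lt with h0 | hpos
      · refine ⟨p + Pi.single k 1, mem_of_le hp (le_add_of_nonneg_right ?_), ?_, ?_⟩
        · exact Pi.single_nonneg.2 zero_le_one
        · simp only [Pi.zero_apply] at h0
          simp [dotProduct_add, ← h0]
        · simp [hk]
      · obtain ⟨j, hj, hjk⟩ := hwtight k (by rwa [hwK k hk])
        exact ⟨P j, point_mem j, hj, lt_of_le_of_ne (hb j k) fun h => hjk (h ▸ hk.symm)⟩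
    · exact ⟨p, hp, rfl, lt_of_le_of_ne (lower_bound hb hp k) (Ne.symm hk)⟩
  obtain ⟨k₀, hk₀⟩ : ∃ k, w k = 0 := by
    by_contra! hall
    obtain ⟨q, hq, hqp, hqne⟩ := hdom
    obtain ⟨k, hk⟩ := Function.ne_iff.1 hqne
    have : dotProduct w q < dotProduct w p :=
      sum_lt_sum (fun i _ => mul_le_mul_of_nonneg_left (hqp i) (hwnn i))
        ⟨k, mem_univ k, mul_lt_mul_of_pos_left (lt_of_le_of_ne (hqp k) hk)
          (lt_of_le_of_ne (hwnn k) (hall k).symm)⟩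
    exact absurd (hvalid q hq) (not_le.2 this)
  choose z hz hzw hzb using hex
  have hcard : (0 : ℝ) < Fintype.card ι := by exact_mod_cast Fintype.card_pos_iff.2 ⟨k₀⟩
  set c : ℝ := (Fintype.card ι : ℝ)⁻¹ with hc
  have hc0 : 0 < c := inv_pos.2 hcard
  have hc1 : ∑ _k : ι, c = 1 := by simp [hc, hcard.ne']
  set a : ι → ℝ := ∑ k, c • z k with ha
  have haT : a ∈ upperHull P := convex.sum_mem (fun _ _ => hc0.le) hc1 fun k _ => hz k
  have haw : dotProduct w a = dotProduct w p := by
    simp only [ha, dotProduct_sum, dotProduct_smul, hzw, smul_eq_mul]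
    rw [← sum_mul, hc1, one_mul]
  have hab : ∀ k, b k < a k := by
    intro k
    calc b k = ∑ _i : ι, c * b k := by rw [← sum_mul, hc1, one_mul]
      _ < ∑ i, c * z i k := sum_lt_sum
          (fun i _ => mul_le_mul_of_nonneg_left (lower_bound hb (hz i) k) hc0.le)
          ⟨k, mem_univ k, mul_lt_mul_of_pos_left (hzb k) hc0⟩
      _ = a k := by simp [ha]
  have hle : a ≤ a + Pi.single k₀ (1 : ℝ) :=
    le_add_of_nonneg_right (Pi.single_nonneg.2 zero_le_one)
  obtain ⟨k, hk⟩ := hideal (a + Pi.single k₀ 1) (mem_of_le haT hle) w hwnn hwnz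
    (fun u hu => by
      simp only [dotProduct_add, haw, dotProduct_single, hk₀, zero_mul, add_zero]
      exact hvalid u hu)
    ⟨a, haT, hle, fun h => by simpa using congrFun h k₀⟩
  have h1 := hle k
  have h2 := hab k
  linarith

end upperHull

/-- Stack a production unit into one vector, negating the outputs. -/
def stack (q : (Fin m → ℝ) × (Fin s → ℝ)) : Fin m ⊕ Fin s → ℝ := Sum.elim q.1 (-q.2)

theorem stack_le_iff {q q' : (Fin m → ℝ) × (Fin s → ℝ)} : stack q ≤ stack q' ↔ WeakDom q q' := by
  simp [stack, WeakDom, Pi.le_def]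

theorem stack_injective : Function.Injective (stack : (Fin m → ℝ) × (Fin s → ℝ) → _) := by
  intro q q' h
  refine Prod.ext (funext fun i => congrFun h (Sum.inl i)) (funext fun r => ?_)
  simpa [stack] using congrFun h (Sum.inr r)

theorem stack_surjective : Function.Surjective (stack : (Fin m → ℝ) × (Fin s → ℝ) → _) :=
  fun z => ⟨(fun i => z (Sum.inl i), fun r => -z (Sum.inr r)), by
    funext k
    cases k <;> simp [stack]⟩

theorem stack_mem_upperHull_iff {X : Matrix (Fin m) (Fin n) ℝ} {Y : Matrix (Fin s) (Fin n) ℝ}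
    {q : (Fin m → ℝ) × (Fin s → ℝ)} :
    stack q ∈ upperHull (fun j => stack (fun i => X i j, fun r => Y r j)) ↔ q ∈ Tset X Y := by
  simp only [upperHull, Tset, Set.mem_ofPred_eq, Pi.le_def, Sum.forall, stack, Sum.elim_inl,
    Sum.elim_inr, Pi.neg_apply, mul_neg, sum_neg_distrib, neg_le_neg_iff, Matrix.mulVec,
    dotProduct]
  simp only [mul_comm]

/-- A point minimizing a nonzero nonnegative functional lies on the boundary. -/
theorem mem_frontier_Tset {X : Matrix (Fin m) (Fin n) ℝ} {Y : Matrix (Fin s) (Fin n) ℝ}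
    {q : (Fin m → ℝ) × (Fin s → ℝ)} (hq : q ∈ Tset X Y) {w : Fin m ⊕ Fin s → ℝ}
    (hw : 0 ≤ w) (hw0 : w ≠ 0)
    (h : ∀ u ∈ Tset X Y, dotProduct w (stack q) ≤ dotProduct w (stack u)) :
    q ∈ frontier (Tset X Y) := by
  refine ⟨subset_closure hq, fun hint => ?_⟩
  rw [mem_interior_iff_mem_nhds, Metric.mem_nhds_iff] at hint
  obtain ⟨ε, hε, hball⟩ := hint
  have hmem : (q.1 - fun _ => ε / 2, q.2 + fun _ => ε / 2) ∈ Tset X Y := by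
    refine hball ?_
    rw [Metric.mem_ball, Prod.dist_eq, max_lt_iff, dist_pi_lt_iff hε, dist_pi_lt_iff hε]
    refine ⟨fun i => ?_, fun r => ?_⟩ <;>
      simp [abs_of_pos hε, hε]
  have hst : stack (q.1 - fun _ => ε / 2, q.2 + fun _ => ε / 2)
      = stack q - fun _ => ε / 2 := by
    funext k
    cases k with
    | inl i => simp [stack]
    | inr r =>
      simp only [stack, Sum.elim_inr, Pi.neg_apply, Pi.add_apply, Pi.sub_apply]
      ring
  obtain ⟨k, hk⟩ := Function.ne_iff.1 hw0
  have hpos : 0 < dotProduct w (fun _ => ε / 2) :=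
    sum_pos' (fun i _ => mul_nonneg (hw i) (by positivity))
      ⟨k, mem_univ k, mul_pos (lt_of_le_of_ne (hw k) (Ne.symm hk)) (by positivity)⟩
  have := h _ hmem
  rw [hst, dotProduct_sub] at this
  linarith

theorem stack_idealPoint_le (X : Matrix (Fin m) (Fin n) ℝ) (Y : Matrix (Fin s) (Fin n) ℝ)
    (j : Fin n) (k : Fin m ⊕ Fin s) :
    stack (idealPoint X Y) k ≤ stack (fun i => X i j, fun r => Y r j) k := by
  cases k with
  | inl i => exact ciInf_le (Set.finite_range _).bddBelow j
  | inr r => exact neg_le_neg (le_ciSup (f := fun j => Y r j) (Set.finite_range _).bddAbove j)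

theorem weakDom_idealPoint {X : Matrix (Fin m) (Fin n) ℝ} {Y : Matrix (Fin s) (Fin n) ℝ}
    {q : (Fin m → ℝ) × (Fin s → ℝ)} (hq : q ∈ Tset X Y) : WeakDom (idealPoint X Y) q :=
  stack_le_iff.1 fun k =>
    upperHull.lower_bound (stack_idealPoint_le X Y) (stack_mem_upperHull_iff.2 hq) k

/-- In an ideal technology, a unit that is not strongly efficient can be moved freely, within some
neighbourhood, in all coordinates that differ from the ideal point. -/
theorem IdealTech.exists_ball_subset_FIR {X : Matrix (Fin m) (Fin n) ℝ}
    {Y : Matrix (Fin s) (Fin n) ℝ} (hideal : IdealTech X Y)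
    {p : (Fin m → ℝ) × (Fin s → ℝ)} (hp : p ∈ Tset X Y) (hns : ¬ StrongEff X Y p) :
    ∃ ε > 0, ∀ q : (Fin m → ℝ) × (Fin s → ℝ), dist q p < ε →
      (∀ i, p.1 i = xmin X i → q.1 i = p.1 i) → (∀ r, p.2 r = ymax Y r → q.2 r = p.2 r) →
      q ∈ FIR X Y p := by
  obtain ⟨d, hd, hdp⟩ : ∃ d ∈ Tset X Y, Dom d p := by
    by_contra! h
    exact hns ⟨hp, h⟩
  obtain ⟨ε, hε, hmem⟩ := upperHull.exists_improvement (stack_idealPoint_le X Y)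
    (fun z hz w hw hw0 hws hdom => by
      obtain ⟨q, rfl⟩ := stack_surjective z
      obtain ⟨u, hu, huq, hne⟩ := hdom
      obtain ⟨u, rfl⟩ := stack_surjective u
      rw [stack_mem_upperHull_iff] at hz hu
      rcases hideal q ⟨mem_frontier_Tset hz hw hw0
          fun v hv => hws _ (stack_mem_upperHull_iff.2 hv),
        fun hS => hS.2 u hu ⟨stack_le_iff.1 huq, fun h => hne (h ▸ rfl)⟩⟩ with ⟨i, hi⟩ | ⟨r, hr⟩
      · exact ⟨Sum.inl i, hi⟩
      · exact ⟨Sum.inr r, congrArg Neg.neg hr⟩)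
    (stack_mem_upperHull_iff.2 hp)
    ⟨stack d, stack_mem_upperHull_iff.2 hd, stack_le_iff.2 hdp.1,
      fun h => hdp.2 (stack_injective h)⟩
  refine ⟨ε, hε, fun q hq hq1 hq2 => ⟨stack_mem_upperHull_iff.1 (upperHull.mem_of_le hmem ?_),
    fun i hi => (hq1 i hi).trans hi, fun r hr => (hq2 r hr).trans hr⟩⟩
  rw [Prod.dist_eq, max_lt_iff, dist_pi_lt_iff hε, dist_pi_lt_iff hε] at hq
  simp only [Real.dist_eq, abs_lt] at hq
  intro k
  by_cases h : stack p k = stack (idealPoint X Y) k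
  · refine (if_pos h).trans_le ?_
    cases k with
    | inl i => exact (hq1 i h).ge
    | inr r => exact (congrArg Neg.neg (hq2 r (neg_injective h))).ge
  · refine (if_neg h).trans_le ?_
    cases k with
    | inl i =>
      simp only [stack, Sum.elim_inl]
      linarith [hq.1 i]
    | inr r =>
      simp only [stack, Sum.elim_inr, Pi.neg_apply]
      linarith [hq.2 r]

theorem isExtreme_FIR (X : Matrix (Fin m) (Fin n) ℝ) (Y : Matrix (Fin s) (Fin n) ℝ)
    (p : (Fin m → ℝ) × (Fin s → ℝ)) : IsExtreme ℝ (Tset X Y) (FIR X Y p) := by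
  refine ⟨fun q hq => hq.1, ?_⟩
  rintro x hx y hy z ⟨-, hz1, hz2⟩ ⟨a, b, ha, hb, hab, rfl⟩
  have hx' := weakDom_idealPoint hx
  have hy' := weakDom_idealPoint hy
  refine ⟨hx, fun i hi => ?_, fun r hr => ?_⟩
  · have h := hz1 i hi
    have h1 : xmin X i ≤ x.1 i := hx'.1 i
    have h2 : xmin X i ≤ y.1 i := hy'.1 i
    simp only [Prod.fst_add, Prod.smul_fst, Pi.add_apply, Pi.smul_apply, smul_eq_mul] at h
    obtain rfl : b = 1 - a := by linarith
    nlinarith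
  · have h := hz2 r hr
    have h1 : x.2 r ≤ ymax Y r := hx'.2 r
    have h2 : y.2 r ≤ ymax Y r := hy'.2 r
    simp only [Prod.snd_add, Prod.smul_snd, Pi.add_apply, Pi.smul_apply, smul_eq_mul] at h
    obtain rfl : b = 1 - a := by linarith
    nlinarith

/-- Restriction of a unit to the coordinates in `I` and `R`. -/
def restrictCoords (I : Set (Fin m)) (R : Set (Fin s)) :
    (Fin m → ℝ) × (Fin s → ℝ) →ₗ[ℝ] (I → ℝ) × (R → ℝ) :=
  (LinearMap.funLeft ℝ ℝ Subtype.val).prodMap (LinearMap.funLeft ℝ ℝ Subtype.val)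

theorem mem_ker_restrictCoords {I : Set (Fin m)} {R : Set (Fin s)}
    {v : (Fin m → ℝ) × (Fin s → ℝ)} :
    v ∈ LinearMap.ker (restrictCoords I R) ↔ (∀ i ∈ I, v.1 i = 0) ∧ ∀ r ∈ R, v.2 r = 0 := by
  simp [restrictCoords, funext_iff, LinearMap.funLeft]

theorem finrank_ker_restrictCoords (I : Set (Fin m)) (R : Set (Fin s)) :
    Module.finrank ℝ (LinearMap.ker (restrictCoords I R)) = m + s - I.ncard - R.ncard := by
  classical
  have hsurj : Function.Surjective (restrictCoords I R) :=
    (LinearMap.funLeft_surjective_of_injective ℝ ℝ _ Subtype.val_injective).prodMap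
      (LinearMap.funLeft_surjective_of_injective ℝ ℝ _ Subtype.val_injective)
  have h := LinearMap.finrank_range_add_finrank_ker (restrictCoords I R)
  rw [LinearMap.range_eq_top.2 hsurj, finrank_top] at h
  simp only [Module.finrank_prod, Module.finrank_fintype_fun_eq_card, ← Nat.card_eq_fintype_card,
    Nat.card_fin, Nat.card_coe_set_eq] at h
  omega

/-- in an ideal technology, every point of `T` is either strongly
efficient or lies in the relative interior of the face `F_{I,R}`, which is a face of
`T` of affine dimension `m + s − |I| − |R|`. -/
theorem stmt7 (hn : 0 < n) (X : Matrix (Fin m) (Fin n) ℝ) (Y : Matrix (Fin s) (Fin n) ℝ)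
    (hideal : IdealTech X Y)
    (p : (Fin m → ℝ) × (Fin s → ℝ)) (hp : p ∈ Tset X Y) :
    StrongEff X Y p ∨
      (p ∈ intrinsicInterior ℝ (FIR X Y p) ∧
        IsExtreme ℝ (Tset X Y) (FIR X Y p) ∧
        Module.finrank ℝ ((affineSpan ℝ (FIR X Y p)).direction) =
          m + s - Set.ncard {i : Fin m | p.1 i = xmin X i}
            - Set.ncard {r : Fin s | p.2 r = ymax Y r}) := by
  refine or_iff_not_imp_left.2 fun hns => ?_
  obtain ⟨ε, hε, hball⟩ := hideal.exists_ball_subset_FIR hp hns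
  have hpF : p ∈ FIR X Y p := ⟨hp, fun _ h => h, fun _ h => h⟩
  have hdir : (affineSpan ℝ (FIR X Y p)).direction =
      LinearMap.ker (restrictCoords {i | p.1 i = xmin X i} {r | p.2 r = ymax Y r}) := by
    rw [direction_affineSpan]
    apply le_antisymm
    · refine Submodule.span_le.2 ?_
      rintro _ ⟨x, hx, y, hy, rfl⟩
      refine mem_ker_restrictCoords.2 ⟨fun i hi => ?_, fun r hr => ?_⟩
      · simp [hx.2.1 i hi, hy.2.1 i hi]
      · simp [hx.2.2 r hr, hy.2.2 r hr]
    · intro v hv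
      obtain ⟨hv1, hv2⟩ := mem_ker_restrictCoords.1 hv
      set t : ℝ := ε / (‖v‖ + 1) with ht
      have ht0 : 0 < t := by positivity
      have hmem : p + t • v ∈ FIR X Y p := by
        refine hball _ ?_ (fun i hi => ?_) fun r hr => ?_
        · rw [dist_self_add_left, norm_smul, Real.norm_of_nonneg ht0.le, ht, div_mul_eq_mul_div,
            div_lt_iff₀ (by positivity)]
          nlinarith
        · simp [hv1 i hi]
        · simp [hv2 r hr]
      have h := vsub_mem_vectorSpan ℝ hmem hpF
      rw [vsub_eq_sub, add_sub_cancel_left] at h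
      exact (Submodule.smul_mem_iff _ ht0.ne').1 h
  refine ⟨mem_intrinsicInterior.2 ⟨⟨p, subset_affineSpan ℝ _ hpF⟩, ?_, rfl⟩,
    isExtreme_FIR X Y p, by rw [hdir, finrank_ker_restrictCoords]⟩
  rw [mem_interior_iff_mem_nhds, Metric.mem_nhds_iff]
  refine ⟨ε, hε, ?_⟩
  rintro ⟨q, hq⟩ hqp
  have hv := AffineSubspace.vsub_mem_direction hq (subset_affineSpan ℝ _ hpF)
  rw [hdir, mem_ker_restrictCoords] at hv
  exact hball q hqp (fun i hi => sub_eq_zero.1 (hv.1 i hi)) fun r hr => sub_eq_zero.1 (hv.2 r hr)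

end
end

section
/- Let a GS path-based model on the VRS technology set T use, for some θ_min ∈ [0,1) ∩ D, the GS range directions. Then the following are equivalent: (i) every unit (x_o,y_o) ∈ T with (x_o,y_o) ≠ (x^min, y^max) is projected onto the strongly efficient frontier, i.e., φ_o(θ*_o) ∈ ∂^S T; (ii) T is an ideal technology. -/
open Finset

noncomputable section

variable {m s n : ℕ}

section Technology

variable {X : Matrix (Fin m) (Fin n) ℝ} {Y : Matrix (Fin s) (Fin n) ℝ}

lemma Tset_of_weakDom {p q : (Fin m → ℝ) × (Fin s → ℝ)} (hp : p ∈ Tset X Y)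
    (h : WeakDom p q) : q ∈ Tset X Y := by
  obtain ⟨lam, h0, h1, hx, hy⟩ := hp
  exact ⟨lam, h0, h1, hx.trans h.1, h.2.trans hy⟩

lemma isClosed_Tset (X : Matrix (Fin m) (Fin n) ℝ) (Y : Matrix (Fin s) (Fin n) ℝ) :
    IsClosed (Tset X Y) := by
  have hC : IsClosed {w : stdSimplex ℝ (Fin n) × ((Fin m → ℝ) × (Fin s → ℝ)) |
      X.mulVec w.1 ≤ w.2.1 ∧ w.2.2 ≤ Y.mulVec w.1} := by
    have hX : Continuous fun w : stdSimplex ℝ (Fin n) × ((Fin m → ℝ) × (Fin s → ℝ)) =>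
        X.mulVec (w.1 : Fin n → ℝ) :=
      Continuous.matrix_mulVec continuous_const (continuous_subtype_val.comp continuous_fst)
    have hY : Continuous fun w : stdSimplex ℝ (Fin n) × ((Fin m → ℝ) × (Fin s → ℝ)) =>
        Y.mulVec (w.1 : Fin n → ℝ) :=
      Continuous.matrix_mulVec continuous_const (continuous_subtype_val.comp continuous_fst)
    exact (isClosed_le hX (by fun_prop)).inter (isClosed_le (by fun_prop) hY)
  convert isClosedMap_snd_of_compactSpace _ hC using 1
  ext p
  constructor
  · rintro ⟨lam, h0, h1, hx, hy⟩
    exact ⟨(⟨lam, h0, h1⟩, p), ⟨hx, hy⟩, rfl⟩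
  · rintro ⟨⟨⟨lam, h0, h1⟩, q⟩, ⟨hx, hy⟩, rfl⟩
    exact ⟨lam, h0, h1, hx, hy⟩

lemma xmin_le_of_mem_Tset {p : (Fin m → ℝ) × (Fin s → ℝ)} (hp : p ∈ Tset X Y) :
    xmin X ≤ p.1 := by
  obtain ⟨lam, h0, h1, hx, -⟩ := hp
  intro i
  refine le_trans ?_ (hx i)
  calc xmin X i = ∑ j, xmin X i * lam j := by rw [← Finset.mul_sum, h1, mul_one]
    _ ≤ ∑ j, X i j * lam j := Finset.sum_le_sum fun j _ =>
        mul_le_mul_of_nonneg_right (ciInf_le (Set.finite_range _).bddBelow j) (h0 j)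

lemma le_ymax_of_mem_Tset {p : (Fin m → ℝ) × (Fin s → ℝ)} (hp : p ∈ Tset X Y) :
    p.2 ≤ ymax Y := by
  obtain ⟨lam, h0, h1, -, hy⟩ := hp
  intro r
  refine (hy r).trans ?_
  calc ∑ j, Y r j * lam j ≤ ∑ j, ymax Y r * lam j := Finset.sum_le_sum fun j _ =>
        mul_le_mul_of_nonneg_right
          (le_ciSup (f := fun j => Y r j) (Set.finite_range _).bddAbove j) (h0 j)
    _ = ymax Y r := by rw [← Finset.mul_sum, h1, mul_one]

lemma idealPoint_mem_strongFrontier (h : idealPoint X Y ∈ Tset X Y) :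
    idealPoint X Y ∈ strongFrontier X Y :=
  ⟨h, fun _ hq hd => hd.2 (Prod.ext (le_antisymm hd.1.1 (xmin_le_of_mem_Tset hq))
    (le_antisymm (le_ymax_of_mem_Tset hq) hd.1.2))⟩

lemma mulVec_mem_Tset {lam : Fin n → ℝ} (hlam : lam ∈ stdSimplex ℝ (Fin n)) :
    (X.mulVec lam, Y.mulVec lam) ∈ Tset X Y :=
  ⟨lam, hlam.1, hlam.2, le_rfl, le_rfl⟩

/-- If a point with weights `lam` is strongly efficient, then so is every point whose weights
are supported in the support of `lam`. -/
lemma strongEff_of_support_subset {lam mu : Fin n → ℝ} (hlam : lam ∈ stdSimplex ℝ (Fin n))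
    (hmu : mu ∈ stdSimplex ℝ (Fin n)) (hsupp : ∀ j, lam j = 0 → mu j = 0)
    (heff : StrongEff X Y (X.mulVec lam, Y.mulVec lam)) :
    StrongEff X Y (X.mulVec mu, Y.mulVec mu) := by
  refine ⟨mulVec_mem_Tset hmu, fun q hq hd => ?_⟩
  obtain ⟨δ, hδ, hδ0⟩ : ∃ δ : ℝ, (∀ j, δ * mu j ≤ lam j) ∧ 0 < δ := by
    have h : ∀ᶠ δ : ℝ in nhdsWithin 0 (Set.Ioi 0), ∀ j, δ * mu j ≤ lam j := by
      refine Filter.eventually_all.2 fun j => ?_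
      rcases (hlam.1 j).eq_or_lt with h | h
      · simp [hsupp j h.symm, ← h]
      · have : Filter.Tendsto (fun δ : ℝ => δ * mu j) (nhds 0) (nhds 0) :=
          Continuous.tendsto' (by fun_prop) _ _ (by simp)
        exact ((this.eventually_lt_const h).filter_mono nhdsWithin_le_nhds).mono
          fun _ => le_of_lt
    exact (h.and self_mem_nhdsWithin).exists
  obtain ⟨nu, h0, h1, hx, hy⟩ := hq
  refine heff.2 (X.mulVec lam + δ • (q.1 - X.mulVec mu), Y.mulVec lam + δ • (q.2 - Y.mulVec mu))
    ⟨lam - δ • mu + δ • nu, fun j => ?_, ?_, fun i => ?_, fun r => ?_⟩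
    ⟨⟨fun i => ?_, fun r => ?_⟩, fun he => hd.2 ?_⟩
  · have := mul_nonneg hδ0.le (h0 j)
    have := hδ j
    simp only [Pi.add_apply, Pi.sub_apply, Pi.smul_apply, smul_eq_mul]
    linarith
  · simp [Finset.sum_add_distrib, ← Finset.mul_sum, h1, hlam.2, hmu.2]
  · have := mul_le_mul_of_nonneg_left (hx i) hδ0.le
    simp only [Matrix.mulVec_add, Matrix.mulVec_sub, Matrix.mulVec_smul, Pi.add_apply,
      Pi.sub_apply, Pi.smul_apply, smul_eq_mul]
    linarith
  · have := mul_le_mul_of_nonneg_left (hy r) hδ0.le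
    simp only [Matrix.mulVec_add, Matrix.mulVec_sub, Matrix.mulVec_smul, Pi.add_apply,
      Pi.sub_apply, Pi.smul_apply, smul_eq_mul]
    linarith
  · have := mul_le_mul_of_nonneg_left (hd.1.1 i) hδ0.le
    simp only [Pi.add_apply, Pi.sub_apply, Pi.smul_apply, smul_eq_mul]
    linarith
  · have := mul_le_mul_of_nonneg_left (hd.1.2 r) hδ0.le
    simp only [Pi.add_apply, Pi.sub_apply, Pi.smul_apply, smul_eq_mul]
    linarith
  · simpa [Prod.ext_iff, hδ0.ne', sub_eq_zero] using he

lemma isClosed_strongFrontier (X : Matrix (Fin m) (Fin n) ℝ) (Y : Matrix (Fin s) (Fin n) ℝ) :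
    IsClosed (strongFrontier X Y) := by
  let z : (Fin n → ℝ) → (Fin m → ℝ) × (Fin s → ℝ) := fun lam => (X.mulVec lam, Y.mulVec lam)
  let face : Finset (Fin n) → Set (Fin n → ℝ) := fun S =>
    stdSimplex ℝ (Fin n) ∩ {lam | ∀ j ∉ S, lam j = 0}
  have hz : Continuous z := by
    have hX := (Continuous.matrix_mulVec (continuous_const (y := X)) continuous_id)
    have hY := (Continuous.matrix_mulVec (continuous_const (y := Y)) continuous_id)
    exact hX.prodMk hY
  have hface (S) : IsClosed (z '' face S) := by
    refine (((isCompact_stdSimplex ℝ (Fin n)).inter_right ?_).image hz).isClosed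
    simp only [Set.ofPred_forall]
    exact isClosed_iInter fun j => isClosed_iInter fun _ =>
      isClosed_eq (continuous_apply j) continuous_const
  have hunion : strongFrontier X Y =
      ⋃ S ∈ {S : Finset (Fin n) | ∀ mu ∈ face S, StrongEff X Y (z mu)}, z '' face S := by
    ext p
    simp only [Set.mem_iUnion]
    constructor
    · intro hp
      obtain ⟨lam, h0, h1, hx, hy⟩ := hp.1
      have hlam : lam ∈ stdSimplex ℝ (Fin n) := ⟨h0, h1⟩
      have hzp : z lam = p := by
        by_contra hne
        exact hp.2 _ (mulVec_mem_Tset hlam) ⟨⟨hx, hy⟩, hne⟩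
      refine ⟨Finset.univ.filter fun j => lam j ≠ 0, fun mu hmu => ?_, lam, ⟨hlam, ?_⟩, hzp⟩
      · refine strongEff_of_support_subset hlam hmu.1 (fun j hj => hmu.2 j (by simp [hj])) ?_
        exact (congrArg (StrongEff X Y) hzp).mpr hp
      · intro j hj
        simpa using hj
    · rintro ⟨S, hS, mu, hmu, rfl⟩
      exact hS mu hmu
  rw [hunion]
  exact (Set.toFinite _).isClosed_biUnion fun S _ => hface S

/-- In an ideal technology, a point of `T` is strongly efficient as soon as it is a limit of
points outside `T` that do not exceed the ideal point. -/
lemma IdealTech.mem_strongFrontier (hI : IdealTech X Y) {q : (Fin m → ℝ) × (Fin s → ℝ)}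
    (hq : q ∈ Tset X Y)
    (hlim : q ∈ closure ((Tset X Y)ᶜ ∩ {p | xmin X ≤ p.1 ∧ p.2 ≤ ymax Y})) :
    q ∈ strongFrontier X Y := by
  rw [← (isClosed_strongFrontier X Y).closure_eq]
  rw [Metric.mem_closure_iff] at hlim ⊢
  intro δ hδ
  obtain ⟨p, ⟨hpT, hpx, hpy⟩, hpq⟩ := hlim δ hδ
  let shift : (Fin m → ℝ) × (Fin s → ℝ) → ℝ → (Fin m → ℝ) × (Fin s → ℝ) := fun a ε =>
    (fun i => a.1 i + ε, fun r => a.2 r - ε)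
  have hshift (a) : Filter.Tendsto (shift a) (nhdsWithin 0 (Set.Ioi 0)) (nhds a) :=
    (Continuous.tendsto' (by fun_prop) _ _ (by simp [shift])).mono_left nhdsWithin_le_nhds
  have hpB : Metric.ball q δ ∈ nhds p :=
    Metric.isOpen_ball.mem_nhds (by rwa [Metric.mem_ball, dist_comm])
  obtain ⟨ε, ⟨⟨hqε, hpε⟩, hpεT⟩, hε⟩ :=
    (((((hshift q).eventually (Metric.ball_mem_nhds q hδ)).and
      ((hshift p).eventually hpB)).and
      ((hshift p).eventually ((isClosed_Tset X Y).isOpen_compl.mem_nhds hpT))).and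
      self_mem_nhdsWithin).exists
  replace hε : 0 < ε := hε
  let G : Set ((Fin m → ℝ) × (Fin s → ℝ)) :=
    (Set.univ.pi fun i => Set.Ioi (xmin X i)) ×ˢ (Set.univ.pi fun r => Set.Iio (ymax Y r))
  have hG : Convex ℝ G := (convex_pi fun i _ => convex_Ioi _).prod (convex_pi fun r _ => convex_Iio _)
  have hshiftG (a : (Fin m → ℝ) × (Fin s → ℝ)) (hx : xmin X ≤ a.1) (hy : a.2 ≤ ymax Y) :
      shift a ε ∈ G :=
    ⟨fun i _ => lt_of_le_of_lt (hx i) (lt_add_of_pos_right _ hε),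
      fun r _ => lt_of_lt_of_le (sub_lt_self _ hε) (hy r)⟩
  have hqεT : shift q ε ∈ Tset X Y := Tset_of_weakDom hq
    ⟨fun i => (lt_add_of_pos_right _ hε).le, fun r => (sub_lt_self _ hε).le⟩
  have hconn : IsPreconnected (Metric.ball q δ ∩ G) := ((convex_ball q δ).inter hG).isPreconnected
  obtain ⟨w, ⟨hwB, hwG⟩, hw⟩ : ((Metric.ball q δ ∩ G) ∩ frontier (Tset X Y)).Nonempty := by
    by_contra hne
    rw [Set.not_nonempty_iff_eq_empty] at hne
    have hcover : ∀ w ∈ Metric.ball q δ ∩ G, w ∈ Tset X Y → w ∈ interior (Tset X Y) := by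
      intro w hw hwT
      by_contra hwi
      exact Set.eq_empty_iff_forall_notMem.1 hne w ⟨hw, subset_closure hwT, hwi⟩
    have hqU : shift q ε ∈ Metric.ball q δ ∩ G :=
      ⟨hqε, hshiftG q (xmin_le_of_mem_Tset hq) (le_ymax_of_mem_Tset hq)⟩
    obtain ⟨w, -, hwi, hwT⟩ := hconn _ _ isOpen_interior (isClosed_Tset X Y).isOpen_compl
      (fun w hw => (em (w ∈ Tset X Y)).imp_left (hcover w hw))
      ⟨_, hqU, hcover _ hqU hqεT⟩ ⟨_, ⟨hpε, hshiftG p hpx hpy⟩, hpεT⟩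
    exact hwT (interior_subset hwi)
  refine ⟨w, ?_, by rwa [Metric.mem_ball, dist_comm] at hwB⟩
  by_contra hwS
  rcases hI w ⟨hw, hwS⟩ with ⟨i, hi⟩ | ⟨r, hr⟩
  · exact (hwG.1 i trivial).ne' hi
  · exact (hwG.2 r trivial).ne hr

lemma mem_interior_Tset {p q : (Fin m → ℝ) × (Fin s → ℝ)} (hq : q ∈ Tset X Y)
    (hx : ∀ i, q.1 i < p.1 i) (hy : ∀ r, p.2 r < q.2 r) : p ∈ interior (Tset X Y) := by
  refine mem_interior.2 ⟨(Set.univ.pi fun i => Set.Ioi (q.1 i)) ×ˢ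
    (Set.univ.pi fun r => Set.Iio (q.2 r)), fun w hw => ?_, ?_, ?_⟩
  · exact Tset_of_weakDom hq ⟨fun i => le_of_lt (hw.1 i trivial), fun r => le_of_lt (hw.2 r trivial)⟩
  · exact (isOpen_set_pi Set.finite_univ fun _ _ => isOpen_Ioi).prod
      (isOpen_set_pi Set.finite_univ fun _ _ => isOpen_Iio)
  · exact ⟨fun i _ => hx i, fun r _ => hy r⟩

end Technology

section Path

variable {P : GSPsi} {X : Matrix (Fin m) (Fin n) ℝ} {Y : Matrix (Fin s) (Fin n) ℝ}
  {θmin θ : ℝ} {p : (Fin m → ℝ) × (Fin s → ℝ)}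

lemma GSPsi.isOpen_Dx (P : GSPsi) : IsOpen P.Dx := by
  rcases P.hDx with h | h <;> rw [h]
  exacts [isOpen_univ, isOpen_Ioi]

lemma GSPsi.isOpen_Dy (P : GSPsi) : IsOpen P.Dy := by
  rcases P.hDy with h | h <;> rw [h]
  exacts [isOpen_univ, isOpen_Ioi]

lemma GSPsi.isOpen_D (P : GSPsi) : IsOpen P.D := P.isOpen_Dx.inter P.isOpen_Dy

lemma GSPsi.ψx_lt_one (hD : θ ∈ P.D) (hθ : θ < 1) : P.ψx θ < 1 :=
  (P.hψx_mono hD.1 P.hone_x hθ).trans_eq P.hψx_one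

lemma GSPsi.one_lt_ψy (hD : θ ∈ P.D) (hθ : θ < 1) : 1 < P.ψy θ :=
  P.hψy_one.symm.trans_lt (P.hψy_anti hD.2 P.hone_y hθ)

lemma continuousAt_pathR (hθ : θ ∈ P.D) : ContinuousAt (pathR P X Y θmin p) θ := by
  have hx : ContinuousAt P.ψx θ :=
    (P.hψx_diff.differentiableAt (P.isOpen_Dx.mem_nhds hθ.1)).continuousAt
  have hy : ContinuousAt P.ψy θ :=
    (P.hψy_diff.differentiableAt (P.isOpen_Dy.mem_nhds hθ.2)).continuousAt
  unfold pathR pathRx pathRy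
  fun_prop

lemma feasibleR_iff : feasibleR P X Y θmin p θ ↔ θ ∈ P.D ∧ pathR P X Y θmin p θ ∈ Tset X Y :=
  Iff.rfl

lemma pathR_one : pathR P X Y θmin p 1 = p := by
  simp [pathR, pathRx, pathRy, P.hψx_one, P.hψy_one]

lemma pathR_fst_sub_xmin (hD : θmin ∈ P.D) (hlt : θmin < 1) (i : Fin m) :
    (pathR P X Y θmin p θ).1 i - xmin X i =
      (P.ψx θ - P.ψx θmin) / (1 - P.ψx θmin) * (p.1 i - xmin X i) := by
  have := sub_pos.2 (GSPsi.ψx_lt_one hD hlt)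
  simp only [pathR, pathRx, rangeDir, Pi.add_apply, Pi.smul_apply, Pi.sub_apply, smul_eq_mul]
  field_simp
  ring

lemma ymax_sub_pathR_snd (hD : θmin ∈ P.D) (hlt : θmin < 1) (r : Fin s) :
    ymax Y r - (pathR P X Y θmin p θ).2 r =
      (P.ψy θmin - P.ψy θ) / (P.ψy θmin - 1) * (ymax Y r - p.2 r) := by
  have := sub_pos.2 (GSPsi.one_lt_ψy hD hlt)
  simp only [pathR, pathRy, rangeDir, Pi.add_apply, Pi.smul_apply, Pi.sub_apply, smul_eq_mul]
  field_simp
  ring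

lemma pathR_θmin (hD : θmin ∈ P.D) (hlt : θmin < 1) :
    pathR P X Y θmin p θmin = idealPoint X Y := by
  refine Prod.ext (funext fun i => ?_) (funext fun r => ?_)
  · have := pathR_fst_sub_xmin (X := X) (Y := Y) (p := p) (θ := θmin) hD hlt i
    rw [sub_self, zero_div, zero_mul, sub_eq_zero] at this
    exact this
  · have := ymax_sub_pathR_snd (X := X) (Y := Y) (p := p) (θ := θmin) hD hlt r
    rw [sub_self, zero_div, zero_mul, sub_eq_zero] at this
    exact this.symm

lemma pathR_mem_idealCone (hp : p ∈ Tset X Y) (hD : θmin ∈ P.D) (hlt : θmin < 1)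
    (hθ : θ ∈ P.D) (hle : θmin ≤ θ) :
    xmin X ≤ (pathR P X Y θmin p θ).1 ∧ (pathR P X Y θmin p θ).2 ≤ ymax Y := by
  have hx := GSPsi.ψx_lt_one hD hlt
  have hy := GSPsi.one_lt_ψy hD hlt
  refine ⟨fun i => sub_nonneg.1 ?_, fun r => sub_nonneg.1 ?_⟩
  · rw [pathR_fst_sub_xmin hD hlt]
    exact mul_nonneg (div_nonneg (sub_nonneg.2 (P.hψx_mono.monotoneOn hD.1 hθ.1 hle))
      (sub_pos.2 hx).le) (sub_nonneg.2 (xmin_le_of_mem_Tset hp i))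
  · rw [ymax_sub_pathR_snd hD hlt]
    exact mul_nonneg (div_nonneg (sub_nonneg.2 (P.hψy_anti.antitoneOn hD.2 hθ.2 hle))
      (sub_pos.2 hy).le) (sub_nonneg.2 (le_ymax_of_mem_Tset hp r))

lemma θmin_le_of_feasibleR (hp : p ∈ Tset X Y) (hne : p ≠ idealPoint X Y) (hD : θmin ∈ P.D)
    (hlt : θmin < 1) (hf : feasibleR P X Y θmin p θ) : θmin ≤ θ := by
  by_contra! hθ
  obtain ⟨hθD, hT⟩ := feasibleR_iff.1 hf
  refine hne (Prod.ext (funext fun i => ?_) (funext fun r => ?_))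
  · have h := sub_nonneg.2 (xmin_le_of_mem_Tset hT i)
    rw [pathR_fst_sub_xmin hD hlt] at h
    have hc : (P.ψx θ - P.ψx θmin) / (1 - P.ψx θmin) < 0 :=
      div_neg_of_neg_of_pos (sub_neg.2 (P.hψx_mono hθD.1 hD.1 hθ))
        (sub_pos.2 (GSPsi.ψx_lt_one hD hlt))
    exact le_antisymm (sub_nonpos.1 (nonpos_of_mul_nonneg_right h hc)) (xmin_le_of_mem_Tset hp i)
  · have h := sub_nonneg.2 (le_ymax_of_mem_Tset hT r)
    rw [ymax_sub_pathR_snd hD hlt] at h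
    have hc : (P.ψy θmin - P.ψy θ) / (P.ψy θmin - 1) < 0 :=
      div_neg_of_neg_of_pos (sub_neg.2 (P.hψy_anti hθD.2 hD.2 hθ))
        (sub_pos.2 (GSPsi.one_lt_ψy hD hlt))
    exact le_antisymm (le_ymax_of_mem_Tset hp r) (sub_nonpos.1 (nonpos_of_mul_nonneg_right h hc))

end Path

/-- with GS range directions, every unit other than the ideal point is
projected onto the strongly efficient frontier if and only if `T` is an ideal
technology. -/
theorem stmt8 (hn : 0 < n) (X : Matrix (Fin m) (Fin n) ℝ) (Y : Matrix (Fin s) (Fin n) ℝ)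
    (P : GSPsi) (θmin : ℝ) (hθ : θmin ∈ Set.Ico (0 : ℝ) 1 ∩ P.D)
    (score : ((Fin m → ℝ) × (Fin s → ℝ)) → ℝ)
    (hscore : ∀ p ∈ Tset X Y, p ≠ idealPoint X Y →
      IsLeast {θ | feasibleR P X Y θmin p θ} (score p)) :
    (∀ p ∈ Tset X Y, p ≠ idealPoint X Y →
        pathR P X Y θmin p (score p) ∈ strongFrontier X Y) ↔
      IdealTech X Y := by
  obtain ⟨⟨-, hlt⟩, hD⟩ := hθ
  constructor
  · intro h p hp
    by_contra! hcon
    obtain ⟨hpx, hpy⟩ := hcon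
    have hpT : p ∈ Tset X Y := (isClosed_Tset X Y).frontier_subset hp.1
    have hne : p ≠ idealPoint X Y := by
      rintro rfl
      exact hp.2 (idealPoint_mem_strongFrontier hpT)
    have hstrong := h p hpT hne
    obtain ⟨hfeas, hleast⟩ := hscore p hpT hne
    have hone : feasibleR P X Y θmin p 1 :=
      feasibleR_iff.2 ⟨⟨P.hone_x, P.hone_y⟩, by rwa [pathR_one]⟩
    rcases (hleast hone).eq_or_lt with h1 | h1
    · rw [h1, pathR_one] at hstrong
      exact hp.2 hstrong
    · refine hp.1.2 (mem_interior_Tset hstrong.1 (fun i => ?_) fun r => ?_)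
      · have hgap := (xmin_le_of_mem_Tset hpT i).lt_of_ne (hpx i).symm
        exact add_lt_of_neg_right _ (mul_neg_of_neg_of_pos
          (sub_neg.2 (GSPsi.ψx_lt_one hfeas.1 h1))
          (mul_pos (inv_pos.2 (sub_pos.2 (GSPsi.ψx_lt_one hD hlt))) (sub_pos.2 hgap)))
      · have hgap := (le_ymax_of_mem_Tset hpT r).lt_of_ne (hpy r)
        exact lt_add_of_pos_right _ (mul_pos
          (sub_pos.2 (GSPsi.one_lt_ψy hfeas.1 h1))
          (mul_pos (inv_pos.2 (sub_pos.2 (GSPsi.one_lt_ψy hD hlt))) (sub_pos.2 hgap)))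
  · intro hI p hpT hne
    obtain ⟨hfeas, hleast⟩ := hscore p hpT hne
    obtain ⟨hsD, hsT⟩ := feasibleR_iff.1 hfeas
    rcases (θmin_le_of_feasibleR hpT hne hD hlt hfeas).eq_or_lt with h | h
    · rw [← h, pathR_θmin hD hlt] at hsT ⊢
      exact idealPoint_mem_strongFrontier hsT
    · refine hI.mem_strongFrontier hsT (mem_closure_of_tendsto
        ((continuousAt_pathR hsD).tendsto.mono_left
          (nhdsWithin_le_nhds (s := Set.Iio (score p)))) ?_)
      filter_upwards [self_mem_nhdsWithin, nhdsWithin_le_nhds (P.isOpen_D.mem_nhds hsD),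
        nhdsWithin_le_nhds (Ioi_mem_nhds h)] with θ hθs hθD hθm
      exact ⟨fun hT => hθs.not_ge (hleast (feasibleR_iff.2 ⟨hθD, hT⟩)),
        pathR_mem_idealCone hpT hD hlt hθD (le_of_lt hθm)⟩

end
end

section
/- The VRS technology set T is an ideal technology if and only if there exist finitely many triples (u_k, v_k, σ_k), k = 1,…,K (possibly K = 0), with u_k ∈ ℝ^s, u_k > 0 componentwise, v_k ∈ ℝ^m, v_k > 0 componentwise, σ_k ∈ ℝ, such that T = {(x,y) ∈ ℝ^m × ℝ^s : x_i ≥ x^min_i for all i, y_r ≤ y^max_r for all r, and u_k^T y − v_k^T x ≤ σ_k for all k}. -/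
open Finset

noncomputable section

variable {m s n : ℕ}

section Polyhedral

variable {V : Type*} [AddCommGroup V] [Module ℝ V]

/-- Fourier–Motzkin elimination of a ray: the sum of a polyhedral cone and a ray is polyhedral. -/
lemma exists_finset_dual_add_ray (F : Finset (V →ₗ[ℝ] ℝ)) (v : V) :
    ∃ F' : Finset (V →ₗ[ℝ] ℝ), ∀ x, (∀ f ∈ F', 0 ≤ f x) ↔
      ∃ t : ℝ, 0 ≤ t ∧ ∀ f ∈ F, 0 ≤ f (x - t • v) := by
  classical
  refine ⟨{f ∈ F | 0 ≤ f v} ∪ (({f ∈ F | 0 < f v} ×ˢ {f ∈ F | f v < 0}).image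
    fun p => (-(p.2 v)) • p.1 + (p.1 v) • p.2), fun x => ⟨fun h => ?_, ?_⟩⟩
  · have hnonneg : ∀ f ∈ F, 0 ≤ f v → 0 ≤ f x := fun f hf hfv =>
      h f (mem_union_left _ (mem_filter.2 ⟨hf, hfv⟩))
    have hpair : ∀ f ∈ F, ∀ g ∈ F, 0 < f v → g v < 0 →
        0 ≤ -(g v) * f x + f v * g x := fun f hf g hg hfv hgv => by
      have := h _ (mem_union_right _ (mem_image_of_mem _
        (mk_mem_product (mem_filter.2 ⟨hf, hfv⟩) (mem_filter.2 ⟨hg, hgv⟩))))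
      simpa using this
    set L : Finset ℝ := insert 0 ({f ∈ F | f v < 0}.image fun f => f x / f v)
    have hLne : L.Nonempty := insert_nonempty _ _
    refine ⟨L.max' hLne, le_max' _ _ (mem_insert_self _ _), fun f hf => ?_⟩
    rw [map_sub, map_smul, smul_eq_mul, sub_nonneg]
    rcases lt_trichotomy (f v) 0 with hfv | hfv | hfv
    · have := le_max' L (f x / f v)
        (mem_insert_of_mem (mem_image_of_mem _ (mem_filter.2 ⟨hf, hfv⟩)))
      rwa [div_le_iff_of_neg hfv] at this
    · simpa [hfv] using hnonneg f hf hfv.ge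
    · rw [← le_div_iff₀ hfv]
      refine max'_le _ _ _ fun y hy => ?_
      rcases mem_insert.1 hy with rfl | hy
      · exact div_nonneg (hnonneg f hf hfv.le) hfv.le
      · obtain ⟨g, hg, rfl⟩ := mem_image.1 hy
        obtain ⟨hg, hgv⟩ := mem_filter.1 hg
        have := hpair f hf g hg hfv hgv
        rw [le_div_iff₀ hfv, div_mul_eq_mul_div, div_le_iff_of_neg hgv]
        linarith
  · rintro ⟨t, ht, h⟩ f hf
    simp only [map_sub, map_smul, smul_eq_mul, sub_nonneg] at h
    rcases mem_union.1 hf with hf | hf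
    · obtain ⟨hf, hfv⟩ := mem_filter.1 hf
      exact (mul_nonneg ht hfv).trans (h f hf)
    · obtain ⟨⟨a, b⟩, hab, rfl⟩ := mem_image.1 hf
      simp only [mem_product, mem_filter] at hab
      obtain ⟨⟨ha, hav⟩, hb, hbv⟩ := hab
      simp only [LinearMap.add_apply, LinearMap.smul_apply, smul_eq_mul]
      nlinarith [h a ha, h b hb]

/-- Finitely generated cones in a finite-dimensional space are polyhedral. -/
lemma exists_finset_dual_eq_cone [FiniteDimensional ℝ V] {κ : Type*} (S : Finset κ)
    (g : κ → V) :
    ∃ F : Finset (V →ₗ[ℝ] ℝ), ∀ x, (∀ f ∈ F, 0 ≤ f x) ↔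
      ∃ c : κ → ℝ, (∀ j ∈ S, 0 ≤ c j) ∧ x = ∑ j ∈ S, c j • g j := by
  classical
  induction S using Finset.induction_on with
  | empty =>
    let b := Module.finBasis ℝ V
    refine ⟨univ.image b.coord ∪ univ.image fun i => -b.coord i, fun x => ⟨fun h => ?_, ?_⟩⟩
    · refine ⟨0, by simp, ?_⟩
      rw [sum_empty, ← b.forall_coord_eq_zero_iff]
      intro i
      have h₁ := h (b.coord i) (mem_union_left _ (mem_image_of_mem _ (mem_univ i)))
      have h₂ := h (-b.coord i) (mem_union_right _ (mem_image.2 ⟨i, mem_univ i, rfl⟩))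
      rw [LinearMap.neg_apply] at h₂
      linarith
    · rintro ⟨c, -, rfl⟩ f -
      simp
  | insert a S ha ih =>
    obtain ⟨F, hF⟩ := ih
    obtain ⟨F', hF'⟩ := exists_finset_dual_add_ray F (g a)
    refine ⟨F', fun x => (hF' x).trans ⟨?_, ?_⟩⟩
    · rintro ⟨t, ht, h⟩
      obtain ⟨c, hc, hx⟩ := (hF _).1 h
      have hne : ∀ j ∈ S, j ≠ a := fun j hj hja => ha (hja ▸ hj)
      refine ⟨Function.update c a t, fun j hj => ?_, ?_⟩
      · rcases mem_insert.1 hj with rfl | hj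
        · simpa using ht
        · simpa [hne j hj] using hc j hj
      · rw [sum_insert ha, Function.update_self,
          sum_congr rfl fun j hj => by rw [Function.update_of_ne (hne j hj)], ← hx]
        abel
    · rintro ⟨c, hc, rfl⟩
      refine ⟨c a, hc a (mem_insert_self _ _), (hF _).2
        ⟨c, fun j hj => hc j (mem_insert_of_mem hj), ?_⟩⟩
      rw [sum_insert ha, add_sub_cancel_left]

end Polyhedral

section Orthant

open Filter
open scoped Topology

variable {ι : Type*} [Fintype ι]

/-- The sum of a polytope and the nonnegative orthant is cut out by finitely many
inequalities with nonnegative coefficients. -/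
lemma exists_halfspaces_hull_add_orthant {n : ℕ} (P : Fin n → ι → ℝ) :
    ∃ F : Finset ((ι → ℝ) × ℝ), (∀ q ∈ F, 0 ≤ q.1) ∧
      ∀ z, (∀ q ∈ F, q.2 ≤ q.1 ⬝ᵥ z) ↔
        ∃ c : Fin n → ℝ, (∀ j, 0 ≤ c j) ∧ ∑ j, c j = 1 ∧ ∑ j, c j • P j ≤ z := by
  classical
  obtain ⟨F, hF⟩ := exists_finset_dual_eq_cone (V := (ι → ℝ) × ℝ) (univ : Finset (Fin n ⊕ ι))
    (Sum.elim (fun j => (P j, 1)) fun i => (Pi.single i 1, 0))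
  have key : ∀ f : ((ι → ℝ) × ℝ) →ₗ[ℝ] ℝ, ∀ z : ι → ℝ,
      f (z, 1) = (fun i => f (Pi.single i 1, 0)) ⬝ᵥ z + f (0, 1) := fun f z => by
    have h : ((z, 1) : (ι → ℝ) × ℝ) =
        ∑ i, z i • ((Pi.single i 1, 0) : (ι → ℝ) × ℝ) + (0, 1) := by
      ext k
      · simp [Prod.fst_sum, Finset.sum_apply, Pi.single_apply]
      · simp [Prod.snd_sum]
    rw [h, map_add, map_sum]
    simp only [map_smul, smul_eq_mul, dotProduct, mul_comm]
  refine ⟨F.image fun f => (fun i => f (Pi.single i 1, 0), -f (0, 1)), ?_, fun z => ?_⟩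
  · intro q hq i
    obtain ⟨f, hf, rfl⟩ := mem_image.1 hq
    refine (hF _).2 ⟨Pi.single (Sum.inr i) 1, fun j _ => ?_, ?_⟩ f hf
    · by_cases h : j = Sum.inr i
      · subst h; simp
      · simp [h]
    · simp [Pi.single_apply, ite_smul]
  · have h : (∀ q ∈ F.image fun f => ((fun i => f (Pi.single i 1, 0) : ι → ℝ), -f (0, 1)),
        q.2 ≤ q.1 ⬝ᵥ z) ↔ ∀ f ∈ F, 0 ≤ f (z, 1) := by
      simp only [mem_image, forall_exists_index, and_imp, forall_apply_eq_imp_iff₂]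
      refine forall₂_congr fun f _ => ?_
      rw [key f z]
      constructor <;> intro h <;> linarith
    rw [h, hF]
    simp only [mem_univ, forall_true_left, Fintype.sum_sum_type, Sum.elim_inl, Sum.elim_inr]
    constructor
    · rintro ⟨c, hc, hz⟩
      refine ⟨fun j => c (Sum.inl j), fun j => hc _, ?_, fun i => ?_⟩
      · have := congrArg Prod.snd hz
        simpa [Prod.snd_sum] using this.symm
      · have := congrFun (congrArg Prod.fst hz) i
        simp only [Prod.fst_add, Prod.fst_sum, Prod.smul_fst, Pi.add_apply, Finset.sum_apply,
          Pi.smul_apply, Pi.single_apply, smul_eq_mul, mul_ite, mul_one, mul_zero,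
          sum_ite_eq, mem_univ, if_true] at this
        rw [this]
        simpa [Finset.sum_apply] using hc (Sum.inr i)
    · rintro ⟨c, hc, hsum, hz⟩
      refine ⟨Sum.elim c fun i => z i - (∑ j, c j • P j) i, ?_, ?_⟩
      · rintro (j | i)
        · exact hc j
        · exact sub_nonneg.2 (hz i)
      · ext k
        · simp [Prod.fst_sum, Finset.sum_apply, Pi.single_apply]
        · simp [Prod.snd_sum, hsum]

/-- If a set cut out by `w ≤ z` and finitely many inequalities with nonnegative coefficients has
only minimal boundary points, except those sharing a coordinate with `w`, then the inequalities
can be chosen with positive coefficients. -/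
lemma exists_pos_halfspaces {T : Set (ι → ℝ)} {w : ι → ℝ} (hne : T.Nonempty)
    (hideal : ∀ p ∈ T, T ∉ 𝓝 p → (∃ q ∈ T, q ≤ p ∧ q ≠ p) → ∃ i, p i = w i)
    (B : Finset ((ι → ℝ) × ℝ)) (hB : ∀ q ∈ B, 0 ≤ q.1) :
    ∀ G : Finset ((ι → ℝ) × ℝ), (∀ q ∈ G, ∀ i, 0 < q.1 i) →
      (∀ z, z ∈ T ↔ w ≤ z ∧ (∀ q ∈ B, q.2 ≤ q.1 ⬝ᵥ z) ∧ ∀ q ∈ G, q.2 ≤ q.1 ⬝ᵥ z) →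
      ∃ G : Finset ((ι → ℝ) × ℝ), (∀ q ∈ G, ∀ i, 0 < q.1 i) ∧
        ∀ z, z ∈ T ↔ w ≤ z ∧ ∀ q ∈ G, q.2 ≤ q.1 ⬝ᵥ z := by
  classical
  induction B using Finset.induction_on with
  | empty => exact fun G hG hT => ⟨G, hG, by simpa using hT⟩
  | insert q B hqB ih =>
    intro G hG hT
    replace ih := ih fun r hr => hB r (mem_insert_of_mem hr)
    have hq : 0 ≤ q.1 := hB q (mem_insert_self _ _)
    simp only [forall_mem_insert] at hT
    by_cases hpos : ∀ i, 0 < q.1 i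
    · refine ih (insert q G) ((forall_mem_insert _ _ _).2 ⟨hpos, hG⟩) fun z => ?_
      rw [hT, forall_mem_insert]
      tauto
    refine ih G hG fun z => ⟨fun hz => ?_, fun hz => ?_⟩
    · have := (hT z).1 hz
      exact ⟨this.1, this.2.1.2, this.2.2⟩
    by_contra hzT
    obtain ⟨hwz, hzB, hzG⟩ := hz
    have hzq : q.1 ⬝ᵥ z < q.2 := by
      by_contra! h
      exact hzT ((hT z).2 ⟨hwz, ⟨h, hzB⟩, hzG⟩)
    obtain ⟨z₁, hz₁⟩ := hne
    obtain ⟨hwz₁, ⟨hz₁q, hz₁B⟩, hz₁G⟩ := (hT z₁).1 hz₁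
    have sum_pos_of_ne : ∀ a : ι → ℝ, 0 ≤ a → a ≠ 0 → 0 < a ⬝ᵥ 1 := fun a ha ha0 => by
      obtain ⟨i, hi⟩ := Function.ne_iff.1 ha0
      rw [dotProduct_one]
      exact sum_pos' (fun i _ => ha i) ⟨i, mem_univ i, lt_of_le_of_ne (ha i) (Ne.symm hi)⟩
    have hq0 : q.1 ≠ 0 := fun h => by
      rw [h, zero_dotProduct] at hz₁q hzq
      linarith
    have hq1 := sum_pos_of_ne _ hq hq0
    set α := q.2 - q.1 ⬝ᵥ z with hα
    set β := q.1 ⬝ᵥ (z₁ + 1) - q.2 with hβ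
    have hα0 : 0 < α := sub_pos.2 hzq
    have hβ0 : 0 < β := by rw [hβ, dotProduct_add]; linarith
    obtain ⟨t, ht, ht0, ht1⟩ : ∃ t : ℝ, t * (α + β) = α ∧ 0 < t ∧ t < 1 :=
      ⟨α / (α + β), div_mul_cancel₀ _ (by positivity), by positivity,
        (div_lt_one (by positivity)).2 (by linarith)⟩
    set p := (1 - t) • z + t • (z₁ + 1) with hp
    have hdot : ∀ a : ι → ℝ, a ⬝ᵥ p = (1 - t) * (a ⬝ᵥ z) + t * (a ⬝ᵥ z₁ + a ⬝ᵥ 1) := fun a => by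
      simp only [hp, dotProduct_add, dotProduct_smul, smul_eq_mul]
    have hqp : q.1 ⬝ᵥ p = q.2 := by
      rw [hβ, hα, dotProduct_add] at ht
      rw [hdot]
      linarith
    have hwp : ∀ i, w i < p i := fun i => by
      have h₁ := hwz i
      have h₂ := hwz₁ i
      simp only [hp, Pi.add_apply, Pi.smul_apply, Pi.one_apply, smul_eq_mul]
      nlinarith
    have hstrict : ∀ r : (ι → ℝ) × ℝ, 0 ≤ r.1 → r.1 ≠ 0 → r.2 ≤ r.1 ⬝ᵥ z → r.2 ≤ r.1 ⬝ᵥ z₁ →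
        r.2 < r.1 ⬝ᵥ p := fun r hr hr0 h₁ h₂ => by
      have := sum_pos_of_ne _ hr hr0
      rw [hdot]
      nlinarith
    have hcont : ∀ a d : ι → ℝ, ∀ c : ℝ, c < a ⬝ᵥ p →
        ∀ᶠ ε in 𝓝[>] (0 : ℝ), c ≤ a ⬝ᵥ (p - ε • d) := fun a d c h => by
      have hc : Continuous fun ε : ℝ => a ⬝ᵥ (p - ε • d) := by
        simp only [dotProduct]
        fun_prop
      have := (hc.tendsto 0).eventually_const_le (u := c) (by simpa using h)
      exact this.filter_mono nhdsWithin_le_nhds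
    have hmove : ∀ d : ι → ℝ, ∀ᶠ ε in 𝓝[>] (0 : ℝ), w ≤ p - ε • d ∧
        (∀ r ∈ B, r.2 ≤ r.1 ⬝ᵥ (p - ε • d)) ∧ ∀ r ∈ G, r.2 ≤ r.1 ⬝ᵥ (p - ε • d) := fun d => by
      have hslack : ∀ r : (ι → ℝ) × ℝ, 0 ≤ r.1 → r.2 ≤ r.1 ⬝ᵥ z → r.2 ≤ r.1 ⬝ᵥ z₁ →
          ∀ᶠ ε in 𝓝[>] (0 : ℝ), r.2 ≤ r.1 ⬝ᵥ (p - ε • d) := fun r hr h₁ h₂ => by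
        by_cases hr0 : r.1 = 0
        · simpa [hr0] using h₁
        · exact hcont _ _ _ (hstrict r hr hr0 h₁ h₂)
      refine .and ?_ (.and ?_ ?_)
      · refine (eventually_all.2 fun i => ?_ : ∀ᶠ ε in 𝓝[>] (0 : ℝ), ∀ i, w i ≤ (p - ε • d) i)
        simpa using hcont (Pi.single i 1) d (w i) (by simpa using hwp i)
      · exact (eventually_all_finset B).2 fun r hr =>
          hslack r (hB r (mem_insert_of_mem hr)) (hzB r hr) (hz₁B r hr)
      · exact (eventually_all_finset G).2 fun r hr =>
          hslack r (fun i => (hG r hr i).le) (hzG r hr) (hz₁G r hr)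
    have hpT : p ∈ T := by
      obtain ⟨ε, h⟩ := (hmove 0).exists
      rw [smul_zero, sub_zero] at h
      exact (hT p).2 ⟨h.1, ⟨hqp.ge, h.2.1⟩, h.2.2⟩
    have hpN : T ∉ 𝓝 p := fun hN => by
      have hc : Tendsto (fun ε : ℝ => p - ε • (1 : ι → ℝ)) (𝓝[>] 0) (𝓝 p) := by
        have : Continuous fun ε : ℝ => p - ε • (1 : ι → ℝ) := by fun_prop
        simpa using (this.tendsto 0).mono_left nhdsWithin_le_nhds
      obtain ⟨ε, hε, hε0⟩ := ((hc.eventually_mem hN).and self_mem_nhdsWithin).exists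
      have h := ((hT _).1 hε).2.1.1
      rw [dotProduct_sub, dotProduct_smul, hqp, smul_eq_mul] at h
      have : 0 < ε * (q.1 ⬝ᵥ 1) := mul_pos hε0 hq1
      linarith
    obtain ⟨i, hi⟩ := not_forall.1 hpos
    have hi0 : q.1 i = 0 := le_antisymm (not_lt.1 hi) (hq i)
    obtain ⟨ε, ⟨hε₁, hε₂, hε₃⟩, hε0⟩ :=
      ((hmove (Pi.single i 1)).and self_mem_nhdsWithin).exists
    replace hε0 : 0 < ε := hε0
    obtain ⟨k, hk⟩ := hideal p hpT hpN ⟨p - ε • Pi.single i 1,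
      (hT _).2 ⟨hε₁, ⟨by simp [dotProduct_sub, hi0, hqp], hε₂⟩, hε₃⟩,
      sub_le_self _ (smul_nonneg hε0.le (Pi.single_nonneg.2 zero_le_one)), fun h => by
        have := congrFun h i
        simp at this
        exact hε0.ne' this⟩
    exact (hwp k).ne' hk

/-- Boundary points of a set cut out by `w ≤ z` and finitely many inequalities with positive
coefficients are minimal, unless they share a coordinate with `w`. -/
lemma exists_eq_of_pos_halfspaces {T : Set (ι → ℝ)} {w : ι → ℝ} {G : Finset ((ι → ℝ) × ℝ)}
    (hG : ∀ q ∈ G, ∀ i, 0 < q.1 i) (hT : ∀ z, z ∈ T ↔ w ≤ z ∧ ∀ q ∈ G, q.2 ≤ q.1 ⬝ᵥ z)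
    {p : ι → ℝ} (hp : p ∈ T) (hpN : T ∉ 𝓝 p) (hdom : ∃ q ∈ T, q ≤ p ∧ q ≠ p) :
    ∃ i, p i = w i := by
  by_contra! hne
  obtain ⟨z, hz, hzp, hzne⟩ := hdom
  have hwp : ∀ i, w i < p i := fun i => lt_of_le_of_ne (((hT p).1 hp).1 i) (hne i).symm
  obtain ⟨i, hi⟩ := Function.ne_iff.1 hzne
  have hstrict : ∀ q ∈ G, q.2 < q.1 ⬝ᵥ p := fun q hq =>
    (((hT z).1 hz).2 q hq).trans_lt <| sum_lt_sum
      (fun j _ => mul_le_mul_of_nonneg_left (hzp j) (hG q hq j).le)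
      ⟨i, mem_univ i, mul_lt_mul_of_pos_left (lt_of_le_of_ne (hzp i) hi) (hG q hq i)⟩
  refine hpN ?_
  have h₁ : ∀ᶠ z in 𝓝 p, ∀ i, w i ≤ z i := eventually_all.2 fun i =>
    ((continuous_apply i).tendsto p).eventually_const_le (hwp i)
  have h₂ : ∀ᶠ z in 𝓝 p, ∀ q ∈ G, q.2 ≤ q.1 ⬝ᵥ z := (eventually_all_finset G).2 fun q hq => by
    have hc : Continuous fun z : ι → ℝ => q.1 ⬝ᵥ z := by
      simp only [dotProduct]
      fun_prop
    exact (hc.tendsto p).eventually_const_le (hstrict q hq)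
  filter_upwards [h₁, h₂] with z h₁ h₂ using (hT z).2 ⟨h₁, h₂⟩

end Orthant

/-- The coordinates `(x, -y)`, in which efficiency means minimality. -/
def minimizationHomeomorph (m s : ℕ) :
    ((Fin m → ℝ) × (Fin s → ℝ)) ≃ₜ (Fin m ⊕ Fin s → ℝ) where
  toFun p := Sum.elim p.1 (-p.2)
  invFun z := (fun i => z (Sum.inl i), fun r => -z (Sum.inr r))
  left_inv p := by ext <;> simp
  right_inv z := by ext (i | r) <;> simp
  continuous_toFun := continuous_pi fun k => by
    rcases k with i | r <;> simp only [Sum.elim_inl, Sum.elim_inr, Pi.neg_apply] <;> fun_prop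
  continuous_invFun := by fun_prop

@[simp] lemma minimizationHomeomorph_inl (p : (Fin m → ℝ) × (Fin s → ℝ)) (i : Fin m) :
    minimizationHomeomorph m s p (Sum.inl i) = p.1 i := rfl

@[simp] lemma minimizationHomeomorph_inr (p : (Fin m → ℝ) × (Fin s → ℝ)) (r : Fin s) :
    minimizationHomeomorph m s p (Sum.inr r) = -p.2 r := rfl

lemma minimizationHomeomorph_le {p q : (Fin m → ℝ) × (Fin s → ℝ)} :
    minimizationHomeomorph m s p ≤ minimizationHomeomorph m s q ↔ WeakDom p q := by
  simp [Pi.le_def, WeakDom]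

lemma dotProduct_minimizationHomeomorph (a : Fin m ⊕ Fin s → ℝ)
    (p : (Fin m → ℝ) × (Fin s → ℝ)) :
    a ⬝ᵥ minimizationHomeomorph m s p =
      ∑ i, a (Sum.inl i) * p.1 i - ∑ r, a (Sum.inr r) * p.2 r := by
  simp [dotProduct, sub_eq_add_neg]

lemma mem_Tset_iff_sum_le (X : Matrix (Fin m) (Fin n) ℝ) (Y : Matrix (Fin s) (Fin n) ℝ)
    (p : (Fin m → ℝ) × (Fin s → ℝ)) :
    p ∈ Tset X Y ↔ ∃ c : Fin n → ℝ, (∀ j, 0 ≤ c j) ∧ ∑ j, c j = 1 ∧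
      ∑ j, c j • minimizationHomeomorph m s (fun i => X i j, fun r => Y r j) ≤
        minimizationHomeomorph m s p := by
  simp [Tset, Pi.le_def, Matrix.mulVec, dotProduct, Finset.sum_apply, mul_comm]

lemma idealPoint_le_of_mem_Tset {X : Matrix (Fin m) (Fin n) ℝ} {Y : Matrix (Fin s) (Fin n) ℝ}
    {p : (Fin m → ℝ) × (Fin s → ℝ)} (hp : p ∈ Tset X Y) : WeakDom (idealPoint X Y) p := by
  obtain ⟨c, hc, hsum, hx, hy⟩ := hp
  refine ⟨fun i => le_trans ?_ (hx i), fun r => (hy r).trans ?_⟩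
  · calc xmin X i = ∑ j, xmin X i * c j := by rw [← mul_sum, hsum, mul_one]
      _ ≤ ∑ j, X i j * c j := sum_le_sum fun j _ =>
        mul_le_mul_of_nonneg_right (ciInf_le (Set.finite_range _).bddBelow j) (hc j)
  · calc ∑ j, Y r j * c j ≤ ∑ j, ymax Y r * c j := sum_le_sum fun j _ =>
        mul_le_mul_of_nonneg_right (le_ciSup (Set.finite_range _).bddAbove j) (hc j)
      _ = ymax Y r := by rw [← mul_sum, hsum, mul_one]

lemma Tset_nonempty (hn : 0 < n) (X : Matrix (Fin m) (Fin n) ℝ)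
    (Y : Matrix (Fin s) (Fin n) ℝ) : (Tset X Y).Nonempty := by
  have h : (0 : Fin n → ℝ) ≤ Pi.single ⟨0, hn⟩ 1 := Pi.single_nonneg.2 zero_le_one
  exact ⟨(_, _), _, h, by simp, le_rfl, le_rfl⟩

open scoped Topology in
/-- The definition of an ideal technology in the coordinates `(x, -y)`. -/
lemma idealTech_iff_minimization {X : Matrix (Fin m) (Fin n) ℝ} {Y : Matrix (Fin s) (Fin n) ℝ}
    (hclosed : IsClosed (Tset X Y)) :
    IdealTech X Y ↔ ∀ p ∈ minimizationHomeomorph m s '' Tset X Y,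
      minimizationHomeomorph m s '' Tset X Y ∉ 𝓝 p →
      (∃ q ∈ minimizationHomeomorph m s '' Tset X Y, q ≤ p ∧ q ≠ p) →
      ∃ i, p i = minimizationHomeomorph m s (idealPoint X Y) i := by
  simp only [Set.forall_mem_image, Set.exists_mem_image, minimizationHomeomorph_le, ne_eq,
    EmbeddingLike.apply_eq_iff_eq, ← (minimizationHomeomorph m s).map_nhds_eq,
    Filter.image_mem_map_iff (minimizationHomeomorph m s).injective, Sum.exists,
    minimizationHomeomorph_inl, minimizationHomeomorph_inr, neg_inj]
  refine forall_congr' fun p => ?_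
  rw [weakFrontier, hclosed.frontier_eq, Set.mem_sdiff, Set.mem_sdiff, mem_interior_iff_mem_nhds]
  simp only [strongFrontier, StrongEff, Dom, idealPoint, Set.mem_ofPred_eq, not_and, not_forall,
    not_not, and_imp]
  refine forall₂_congr fun hp _ => ?_
  simp only [hp, forall_true_left, forall_exists_index, and_imp]

/-- `T` is an ideal technology iff it is the intersection of the special
half-spaces `x_i ≥ x^min_i`, `y_r ≤ y^max_r` with finitely many half-spaces
`u^T y − v^T x ≤ σ` with positive `u`, `v`. -/
theorem stmt11 (hn : 0 < n) (X : Matrix (Fin m) (Fin n) ℝ)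
    (Y : Matrix (Fin s) (Fin n) ℝ) :
    IdealTech X Y ↔
      ∃ (K : ℕ) (u : Fin K → Fin s → ℝ) (v : Fin K → Fin m → ℝ) (σ : Fin K → ℝ),
        (∀ k, (∀ r, 0 < u k r) ∧ (∀ i, 0 < v k i)) ∧
        Tset X Y = {p : (Fin m → ℝ) × (Fin s → ℝ) |
          (∀ i, xmin X i ≤ p.1 i) ∧ (∀ r, p.2 r ≤ ymax Y r) ∧
          ∀ k, (∑ r, u k r * p.2 r) - (∑ i, v k i * p.1 i) ≤ σ k} := by
  classical
  obtain ⟨F, hF, hFT⟩ := exists_halfspaces_hull_add_orthant fun j : Fin n =>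
    minimizationHomeomorph m s (fun i => X i j, fun r => Y r j)
  replace hFT : ∀ p, p ∈ Tset X Y ↔ ∀ q ∈ F, q.2 ≤ q.1 ⬝ᵥ minimizationHomeomorph m s p :=
    fun p => (mem_Tset_iff_sum_le X Y p).trans (hFT _).symm
  have hclosed : IsClosed (Tset X Y) := by
    have : Tset X Y = ⋂ q ∈ F, {p | q.2 ≤ q.1 ⬝ᵥ minimizationHomeomorph m s p} := by
      ext p
      simpa using hFT p
    rw [this]
    refine isClosed_biInter fun q _ => isClosed_le continuous_const ?_
    simp only [dotProduct_minimizationHomeomorph]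
    fun_prop
  rw [idealTech_iff_minimization hclosed]
  constructor
  · intro h
    obtain ⟨G, hG, hGT⟩ := exists_pos_halfspaces ((Tset_nonempty hn X Y).image _) h F hF ∅
      (by simp) ((minimizationHomeomorph m s).surjective.forall.2 fun p => by
        rw [(minimizationHomeomorph m s).injective.mem_set_image, minimizationHomeomorph_le,
          hFT p]
        simpa using fun h => idealPoint_le_of_mem_Tset ((hFT p).2 h))
    refine ⟨G.card, fun k r => (G.equivFin.symm k).1.1 (Sum.inr r),
      fun k i => (G.equivFin.symm k).1.1 (Sum.inl i), fun k => -(G.equivFin.symm k).1.2,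
      fun k => ⟨fun r => hG _ (G.equivFin.symm k).2 _, fun i => hG _ (G.equivFin.symm k).2 _⟩,
      ?_⟩
    ext p
    rw [← (minimizationHomeomorph m s).injective.mem_set_image, hGT, minimizationHomeomorph_le,
      WeakDom, and_assoc]
    refine and_congr_right fun _ => and_congr_right fun _ => ?_
    refine Iff.trans ?_ (G.equivFin.symm.surjective.forall (p := fun q =>
      ∑ r, q.1.1 (Sum.inr r) * p.2 r - ∑ i, q.1.1 (Sum.inl i) * p.1 i ≤ -q.1.2))
    rw [Subtype.forall]
    refine forall₂_congr fun q _ => ?_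
    rw [dotProduct_minimizationHomeomorph]
    constructor <;> intro h <;> linarith
  · rintro ⟨K, u, v, σ, hpos, hT⟩ p hp hpN hdom
    refine exists_eq_of_pos_halfspaces
      (G := univ.image fun k => (Sum.elim (v k) (u k), -σ k)) ?_ ?_ hp hpN hdom
    · simpa [forall_and, and_comm] using hpos
    · refine (minimizationHomeomorph m s).surjective.forall.2 fun p => ?_
      rw [(minimizationHomeomorph m s).injective.mem_set_image, minimizationHomeomorph_le, hT,
        WeakDom, and_assoc]
      refine and_congr_right fun _ => and_congr_right fun _ => ?_
      simp only [mem_image, mem_univ, true_and, forall_exists_index, forall_apply_eq_imp_iff,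
        dotProduct_minimizationHomeomorph, Sum.elim_inl, Sum.elim_inr]
      refine forall_congr' fun k => ?_
      constructor <;> intro h <;> linarith

end
end
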